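/- arXiv:2602.01562 — 4 statements merged into one kernel-verified Lean document; each statement's English description precedes it below -/
import Mathlib

section
/- For all integers n ≥ 2 and k ≥ 2, the local antimagic chromatic number of the firecracker graph F_{n,k} equals nk − n + 1. -/
/-!
Local antimagic (total) labelings and chromatic numbers, firecracker graphs,
stars, double stars, joins, and edge-corona products.
-/

open scoped Classical

noncomputable section

namespace LocalAntimagic

variable {V : Type*} [Fintype V]

/-- The weight of a vertex `u` under an edge labeling `f`: the sum of the
labels of the edges incident with `u`. -/
def weight (G : SimpleGraph V) (f : Sym2 V → ℕ) (u : V) : ℕ :=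
  ∑ e ∈ G.edgeFinset, if u ∈ e then f e else 0

/-- `f` is a local antimagic labeling of `G`: it maps the edge set of `G`
bijectively onto `{1, …, |E(G)|}` and adjacent vertices get distinct weights. -/
def IsLocalAntimagic (G : SimpleGraph V) (f : Sym2 V → ℕ) : Prop :=
  Set.BijOn f G.edgeSet (Set.Icc 1 G.edgeFinset.card) ∧
    ∀ u v, G.Adj u v → weight G f u ≠ weight G f v

/-- The number of distinct colors (vertex weights) induced by `f`. -/
def colorCount (G : SimpleGraph V) (f : Sym2 V → ℕ) : ℕ :=
  (Finset.univ.image (weight G f)).card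

/-- The local antimagic chromatic number `χ_la(G)`: the least number of
distinct induced colors over all local antimagic labelings of `G`. -/
def chiLA (G : SimpleGraph V) : ℕ :=
  sInf {c | ∃ f, IsLocalAntimagic G f ∧ colorCount G f = c}

/-- The total weight of a vertex `u` under a total labeling `(gv, ge)`:
`gv u` plus the sum of the labels of the edges incident with `u`. -/
def totalWeight (G : SimpleGraph V) (gv : V → ℕ) (ge : Sym2 V → ℕ) (u : V) : ℕ :=
  gv u + weight G ge u

/-- `(gv, ge)` is a local antimagic total labeling of `G`: together the vertex
labels and edge labels form a bijection from `V(G) ∪ E(G)` onto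
`{1, …, |V(G)| + |E(G)|}`, and adjacent vertices get distinct total weights. -/
def IsLocalAntimagicTotal (G : SimpleGraph V) (gv : V → ℕ) (ge : Sym2 V → ℕ) : Prop :=
  Set.BijOn (Sum.elim gv ge)
    (Set.range Sum.inl ∪ Sum.inr '' G.edgeSet)
    (Set.Icc 1 (Fintype.card V + G.edgeFinset.card)) ∧
    ∀ u v, G.Adj u v → totalWeight G gv ge u ≠ totalWeight G gv ge v

/-- The number of distinct colors (total vertex weights) induced by `(gv, ge)`. -/
def totalColorCount (G : SimpleGraph V) (gv : V → ℕ) (ge : Sym2 V → ℕ) : ℕ :=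
  (Finset.univ.image (totalWeight G gv ge)).card

/-- The local antimagic total chromatic number `χ_lat(G)`. -/
def chiLAT (G : SimpleGraph V) : ℕ :=
  sInf {c | ∃ gv ge, IsLocalAntimagicTotal G gv ge ∧ totalColorCount G gv ge = c}

/-- The firecracker graph `F_{n,k}`. `Sum.inl i` is the star center `uᵢ`
(`0 ≤ i ≤ n-1`), and `Sum.inr (i, j)` is the star leaf `v_{i,j}`; the vertices
`v_{i,0}` (i.e. `j = 0`, corresponding to `v_{i,1}` in 1-based notation) of
consecutive stars are linked into a path. -/
def firecracker (n k : ℕ) : SimpleGraph (Fin n ⊕ Fin n × Fin k) :=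
  SimpleGraph.fromRel (fun a b =>
    match a, b with
    | Sum.inl i, Sum.inr ⟨i', _⟩ => i = i'
    | Sum.inr ⟨i, j⟩, Sum.inr ⟨i', j'⟩ =>
        (j : ℕ) = 0 ∧ (j' : ℕ) = 0 ∧ (i' : ℕ) = (i : ℕ) + 1
    | _, _ => False)

/-- Index type of the edges. -/
abbrev EIdx (N K : ℕ) := Fin N ⊕ Fin (N + 1) × Fin (K + 1)

/-- The edges of the firecracker. -/
def fe (N K : ℕ) : EIdx N K → Sym2 (Fin (N + 1) ⊕ Fin (N + 1) × Fin (K + 1))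
  | Sum.inl i => s(Sum.inr (i.castSucc, 0), Sum.inr (i.succ, 0))
  | Sum.inr (i, j) => s(Sum.inl i, Sum.inr (i, j))

lemma fe_inj (N K : ℕ) : Function.Injective (fe N K) := by
  rintro (i | ⟨i, j⟩) (i' | ⟨i', j'⟩) h
  · simp only [fe, Sym2.eq_iff, Sum.inr.injEq, Prod.mk.injEq, and_true] at h
    rcases h with ⟨h, _⟩ | ⟨h, h'⟩
    · simpa using h
    · simp only [Fin.ext_iff, Fin.val_castSucc, Fin.val_succ] at h h'
      omega
  · simp [fe, Sym2.eq_iff] at h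
  · simp [fe, Sym2.eq_iff] at h
  · simp only [fe, Sym2.eq_iff] at h
    simp at h
    simp [h]

lemma fe_mem (N K : ℕ) (e : Sym2 (Fin (N + 1) ⊕ Fin (N + 1) × Fin (K + 1))) :
    e ∈ (firecracker (N + 1) (K + 1)).edgeSet ↔ ∃ x, fe N K x = e := by
  constructor
  · induction e using Sym2.ind with
    | _ a b =>
    intro h
    rw [SimpleGraph.mem_edgeSet, firecracker, SimpleGraph.fromRel_adj] at h
    obtain ⟨hne, h⟩ := h
    have key : ∀ i j i' j', ((j : Fin (K+1)) : ℕ) = 0 ∧ ((j' : Fin (K+1)) : ℕ) = 0 ∧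
        ((i' : Fin (N+1)) : ℕ) = ((i : Fin (N+1)) : ℕ) + 1 →
        ∃ x, fe N K x = s(Sum.inr (i, j), Sum.inr (i', j')) := by
      intro i j i' j' h
      refine ⟨Sum.inl ⟨i, by omega⟩, ?_⟩
      have h1 : j = 0 := Fin.ext h.1
      have h2 : j' = 0 := Fin.ext h.2.1
      have h3 : i' = (⟨i, by omega⟩ : Fin N).succ := Fin.ext h.2.2
      subst h1 h2
      exact congrArg (fun z => s(Sum.inr (i, 0), Sum.inr (z, 0))) h3.symm
    rcases a with i | ⟨i, j⟩ <;> rcases b with i' | ⟨i', j'⟩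
    · simp at h
    · simp at h
      subst h
      exact ⟨Sum.inr (i, j'), rfl⟩
    · simp at h
      subst h
      exact ⟨Sum.inr (i', j), Sym2.eq_swap⟩
    · rcases h with h | h
      · exact key _ _ _ _ h
      · rw [Sym2.eq_swap]
        exact key _ _ _ _ h
  · rintro ⟨x, rfl⟩
    rcases x with i | ⟨i, j⟩
    · rw [fe, SimpleGraph.mem_edgeSet, firecracker, SimpleGraph.fromRel_adj]
      refine ⟨?_, Or.inl ⟨rfl, rfl, by simp⟩⟩
      intro h
      have := congrArg Fin.val (congrArg Prod.fst (Sum.inr.inj h))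
      simp at this
    · simp [fe, firecracker]

lemma fe_finset (N K : ℕ) :
    (firecracker (N + 1) (K + 1)).edgeFinset = Finset.univ.map ⟨fe N K, fe_inj N K⟩ := by
  ext e
  rw [SimpleGraph.mem_edgeFinset, fe_mem]
  simp

lemma fe_card (N K : ℕ) :
    (firecracker (N + 1) (K + 1)).edgeFinset.card = N + (N + 1) * (K + 1) := by
  rw [fe_finset]
  simp

lemma weight_eq (N K : ℕ) (f) (u) :
    weight (firecracker (N + 1) (K + 1)) f u =
      ∑ x, if u ∈ fe N K x then f (fe N K x) else 0 := by
  rw [weight, fe_finset, Finset.sum_map]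
  apply Finset.sum_congr rfl
  intro x _
  simp only [Function.Embedding.coeFn_mk]

lemma weight_leaf (N K : ℕ) (f) (i : Fin (N + 1)) (j : Fin (K + 1)) (hj : j ≠ 0) :
    weight (firecracker (N + 1) (K + 1)) f (Sum.inr (i, j)) = f (fe N K (Sum.inr (i, j))) := by
  rw [weight_eq, Finset.sum_eq_single (Sum.inr (i, j))]
  · simp [fe]
  · rintro (i' | ⟨i', j'⟩) _ h
    · simp [fe, hj]
    · rw [if_neg]
      intro h'
      apply h
      simp [fe] at h'
      simp [h']
  · simp

lemma weight_center (N K : ℕ) (f) (i : Fin (N + 1)) :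
    weight (firecracker (N + 1) (K + 1)) f (Sum.inl i) =
      ∑ j, f (fe N K (Sum.inr (i, j))) := by
  rw [weight_eq, Fintype.sum_sum_type, Fintype.sum_prod_type, Finset.sum_eq_zero, zero_add,
    Finset.sum_eq_single i]
  · simp [fe]
  · intro b _ hb
    apply Finset.sum_eq_zero
    intro j _
    rw [if_neg]
    simpa [fe] using hb.symm
  · simp
  · intro x _
    simp [fe]

lemma two_le_weight (N K : ℕ) (f) (u) (x y : EIdx N K) (hxy : x ≠ y)
    (hx : u ∈ fe N K x) (hy : u ∈ fe N K y) :
    f (fe N K x) + f (fe N K y) ≤ weight (firecracker (N + 1) (K + 1)) f u := by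
  rw [weight_eq]
  calc f (fe N K x) + f (fe N K y)
      = ∑ z ∈ {x, y}, if u ∈ fe N K z then f (fe N K z) else 0 := by
        rw [Finset.sum_pair hxy, if_pos hx, if_pos hy]
    _ ≤ _ := Finset.sum_le_sum_of_subset (Finset.subset_univ _)

/-- The set of leaf indices. -/
def leaves (N K : ℕ) : Finset (Fin (N + 1) × Fin (K + 1)) :=
  Finset.univ ×ˢ Finset.univ.erase 0

lemma leaves_card (N K : ℕ) : (leaves N K).card = (N + 1) * K := by
  simp [leaves, Finset.card_product, Finset.card_erase_of_mem]

lemma lower (N K : ℕ) (hK : 1 ≤ K) (f)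
    (hf : IsLocalAntimagic (firecracker (N + 1) (K + 1)) f) :
    (N + 1) * K + 1 ≤ colorCount (firecracker (N + 1) (K + 1)) f := by
  obtain ⟨⟨hmap, hinj, hsurj⟩, -⟩ := hf
  set m := (firecracker (N + 1) (K + 1)).edgeFinset.card with hm
  have hmem : ∀ x, fe N K x ∈ (firecracker (N + 1) (K + 1)).edgeSet :=
    fun x => (fe_mem N K _).2 ⟨x, rfl⟩
  have hr : ∀ x, 1 ≤ f (fe N K x) ∧ f (fe N K x) ≤ m := fun x => hmap (hmem x)
  have hm1 : 1 ≤ m := (hr (Sum.inr (0, 0))).1.trans (hr (Sum.inr (0, 0))).2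
  obtain ⟨e, he, hfe⟩ := hsurj (⟨hm1, le_refl m⟩ : m ∈ Set.Icc 1 m)
  obtain ⟨x, rfl⟩ := (fe_mem N K _).1 he
  have hbig : ∃ u, m < weight (firecracker (N + 1) (K + 1)) f u := by
    rcases x with i | ⟨i, j⟩
    · refine ⟨Sum.inr (i.castSucc, 0), ?_⟩
      have := two_le_weight N K f (Sum.inr (i.castSucc, 0)) (Sum.inl i)
        (Sum.inr (i.castSucc, 0)) (by simp) (by simp [fe]) (by simp [fe])
      have := (hr (Sum.inr (i.castSucc, 0))).1
      omega
    · have : Nontrivial (Fin (K + 1)) := Fin.nontrivial_iff_two_le.2 (by omega)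
      obtain ⟨j', hj'⟩ := exists_ne j
      refine ⟨Sum.inl i, ?_⟩
      have := two_le_weight N K f (Sum.inl i) (Sum.inr (i, j))
        (Sum.inr (i, j')) (by simpa using hj'.symm) (by simp [fe]) (by simp [fe])
      have := (hr (Sum.inr (i, j'))).1
      omega
  obtain ⟨u, hu⟩ := hbig
  have hc : ((leaves N K).image (fun x => f (fe N K (Sum.inr x)))).card = (N + 1) * K := by
    rw [Finset.card_image_of_injective, leaves_card]
    intro a b hab
    have := fe_inj N K (hinj (hmem _) (hmem _) hab)
    simpa using this
  rw [← hc, ← Finset.card_insert_of_notMem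
    (a := weight (firecracker (N + 1) (K + 1)) f u)]
  · apply Finset.card_le_card
    intro y hy
    rw [Finset.mem_insert, Finset.mem_image] at hy
    rcases hy with rfl | ⟨⟨i, j⟩, hx, rfl⟩
    · exact Finset.mem_image_of_mem _ (Finset.mem_univ _)
    · rw [← weight_leaf N K f i j]
      · exact Finset.mem_image_of_mem _ (Finset.mem_univ _)
      · simpa [leaves] using hx
  · intro h
    rw [Finset.mem_image] at h
    obtain ⟨y, _, hy⟩ := h
    have := (hr (Sum.inr y)).2
    omega

/-- Combinatorial certificate for the upper bound. -/
def Good (n k : ℕ) (P : ℕ → ℕ) (t : ℕ → ℕ → ℕ) (C : ℕ) : Prop :=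
  (P 0 = 0 ∧ P n = 0) ∧
  (∀ x < n * k + n, 0 < x → (∃ i < n, 0 < i ∧ P i = x) ∨ ∃ i < n, ∃ j < k, t i j = x) ∧
  (∀ i < n, (∑ j ∈ Finset.range k, t i j) = C ∨
    ∃ i' < n, ∃ j' < k, 0 < j' ∧ t i' j' = ∑ j ∈ Finset.range k, t i j) ∧
  (∀ i < n, (t i 0 + P i + P (i + 1)) = C ∨
    ∃ i' < n, ∃ j' < k, 0 < j' ∧ t i' j' = t i 0 + P i + P (i + 1)) ∧
  (∀ i < n, (∑ j ∈ Finset.range k, t i j) ≠ t i 0 + P i + P (i + 1)) ∧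
  (∀ i < n - 1, t i 0 + P i + P (i + 1) ≠ t (i + 1) 0 + P (i + 1) + P (i + 2))

/-- The edge label of an index. -/
def lab (N K : ℕ) (P : ℕ → ℕ) (t : ℕ → ℕ → ℕ) : EIdx N K → ℕ
  | Sum.inl i => P (i + 1)
  | Sum.inr (i, j) => t i j

lemma sum_path (N : ℕ) (P : ℕ → ℕ) (h0 : P 0 = 0) (hN : P (N + 1) = 0) (i : ℕ) (hi : i ≤ N) :
    (∑ x : Fin N, if i = x ∨ i = x + 1 then P (x + 1) else 0) = P i + P (i + 1) := by
  rw [Fin.sum_univ_eq_sum_range (fun x => if i = x ∨ i = x + 1 then P (x + 1) else 0) N]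
  have : ∀ x, (if i = x ∨ i = x + 1 then P (x + 1) else 0) =
      (if i = x then P (x + 1) else 0) + (if i = x + 1 then P (x + 1) else 0) := by
    intro x
    split_ifs <;> first | omega | simp
  simp_rw [this]
  rw [Finset.sum_add_distrib, Finset.sum_ite_eq, add_comm]
  congr 1
  · rcases i with _ | i
    · simp [h0]
    · simp only [Nat.add_right_cancel_iff]
      rw [Finset.sum_ite_eq, if_pos (by simp; omega)]
  · split_ifs with h
    · rfl
    · have : i = N := by
        simp at h
        omega
      rw [this, hN]

lemma upper (N K : ℕ) (hK : 1 ≤ K) (P t C) (h : Good (N + 1) (K + 1) P t C) :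
    ∃ f, IsLocalAntimagic (firecracker (N + 1) (K + 1)) f ∧
      colorCount (firecracker (N + 1) (K + 1)) f ≤ (N + 1) * K + 1 := by
  obtain ⟨⟨hP0, hPn⟩, hs, hU, hV, hUV, hVV⟩ := h
  set G := firecracker (N + 1) (K + 1) with hG
  set f : Sym2 (Fin (N + 1) ⊕ Fin (N + 1) × Fin (K + 1)) → ℕ :=
    Function.extend (fe N K) (lab N K P t) 0 with hfdef
  have hf : ∀ x, f (fe N K x) = lab N K P t x := fun x => (fe_inj N K).extend_apply _ _ _
  have hmem : ∀ x, fe N K x ∈ G.edgeSet := fun x => (fe_mem N K _).2 ⟨x, rfl⟩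
  have hsub : Finset.Icc 1 G.edgeFinset.card ⊆ G.edgeFinset.image f := by
    intro x hx
    rw [fe_card, Finset.mem_Icc] at hx
    rw [Finset.mem_image]
    rcases hs x (by omega) (by omega) with ⟨i, hi, hi0, rfl⟩ | ⟨i, hi, j, hj, rfl⟩
    · refine ⟨fe N K (Sum.inl ⟨i - 1, by omega⟩), by simpa using hmem _, ?_⟩
      rw [hf]
      simp only [lab]
      congr 1
      omega
    · refine ⟨fe N K (Sum.inr (⟨i, hi⟩, ⟨j, hj⟩)), by simpa using hmem _, ?_⟩
      rw [hf]
      rfl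
  have himg : Finset.Icc 1 G.edgeFinset.card = G.edgeFinset.image f := by
    apply Finset.eq_of_subset_of_card_le hsub
    simpa using Finset.card_image_le
  have hbij : Set.BijOn f G.edgeSet (Set.Icc 1 G.edgeFinset.card) := by
    have hinj : Set.InjOn f (G.edgeFinset : Set _) := by
      apply Finset.card_image_iff.1
      rw [← himg]
      simp
    rw [SimpleGraph.coe_edgeFinset] at hinj
    have : Set.Icc 1 G.edgeFinset.card = f '' G.edgeSet := by
      rw [← Finset.coe_Icc, himg, Finset.coe_image, SimpleGraph.coe_edgeFinset]
    rw [this]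
    exact hinj.bijOn_image
  have hpos : ∀ x, 1 ≤ f (fe N K x) := fun x => (hbij.mapsTo (hmem x)).1
  have wU : ∀ i : Fin (N + 1), weight G f (Sum.inl i) = ∑ j ∈ Finset.range (K + 1), t i j := by
    intro i
    rw [hG, weight_center, ← Fin.sum_univ_eq_sum_range]
    simp [hf, lab]
  have wL : ∀ (i : Fin (N + 1)) (j : Fin (K + 1)), j ≠ 0 →
      weight G f (Sum.inr (i, j)) = t i j := by
    intro i j hj
    rw [hG, weight_leaf _ _ _ _ _ hj, hf]
    rfl
  have wV : ∀ i : Fin (N + 1), weight G f (Sum.inr (i, 0)) = t i 0 + P i + P (i + 1) := by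
    intro i
    rw [hG, weight_eq, Fintype.sum_sum_type, Finset.sum_eq_single (i, 0), add_comm, add_assoc]
    · congr 1
      · rw [hf, if_pos (by simp [fe])]
        rfl
      · rw [← sum_path N P hP0 hPn i (by omega)]
        apply Finset.sum_congr rfl
        intro x _
        rw [hf]
        simp [fe, lab, Fin.ext_iff]
    · rintro ⟨i', j'⟩ _ hne
      rw [if_neg]
      intro h'
      apply hne
      simp [fe] at h'
      simp [h']
    · simp
  refine ⟨f, ⟨hbij, ?_⟩, ?_⟩
  · intro u v huv
    obtain ⟨x, hx⟩ := (fe_mem N K s(u, v)).1 huv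
    have key : ∃ a b, fe N K x = s(a, b) ∧ weight G f a ≠ weight G f b := by
      rcases x with i | ⟨i, j⟩
      · refine ⟨_, _, rfl, ?_⟩
        rw [wV, wV]
        exact hVV i (by omega)
      · refine ⟨_, _, rfl, ?_⟩
        by_cases hj : j = 0
        · subst hj
          rw [wU, wV]
          exact hUV i i.2
        · have h1 := two_le_weight N K f (Sum.inl i) (Sum.inr (i, j)) (Sum.inr (i, 0))
            (by simpa using hj) (by simp [fe]) (by simp [fe])
          have h2 := hpos (Sum.inr (i, 0))
          rw [hG, weight_leaf _ _ _ _ _ hj]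
          omega
    obtain ⟨a, b, hab, hw⟩ := key
    rw [hx, Sym2.eq_iff] at hab
    rcases hab with ⟨rfl, rfl⟩ | ⟨rfl, rfl⟩
    · exact hw
    · exact hw.symm
  · have hc : (insert C ((leaves N K).image (fun x => t x.1 x.2))).card ≤ (N + 1) * K + 1 := by
      refine (Finset.card_insert_le _ _).trans ?_
      have := Finset.card_image_le (s := leaves N K) (f := fun x => t x.1 x.2)
      rw [leaves_card] at this
      omega
    refine le_trans (Finset.card_le_card ?_) hc
    have hin : ∀ w, (w = C ∨ ∃ i' < N + 1, ∃ j' < K + 1, 0 < j' ∧ t i' j' = w) →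
        w ∈ insert C ((leaves N K).image (fun x => t x.1 x.2)) := by
      rintro w (rfl | ⟨i, hi, j, hj, hj0, rfl⟩)
      · exact Finset.mem_insert_self _ _
      · apply Finset.mem_insert_of_mem
        rw [Finset.mem_image]
        refine ⟨(⟨i, hi⟩, ⟨j, hj⟩), ?_, rfl⟩
        simp [leaves, Fin.ext_iff]
        omega
    intro w hw
    rw [Finset.mem_image] at hw
    obtain ⟨u, _, rfl⟩ := hw
    apply hin
    rcases u with i | ⟨i, j⟩
    · rw [wU]
      exact hU i i.2
    · by_cases hj : j = 0
      · subst hj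
        rw [wV]
        exact hV i i.2
      · rw [wL i j hj]
        refine Or.inr ⟨i, i.2, j, j.2, ?_, rfl⟩
        exact Nat.pos_of_ne_zero (fun h => hj (Fin.ext h))

/-- A strong certificate, which survives `k ↦ k + 2`. -/
def Strong (n k : ℕ) (P : ℕ → ℕ) (t : ℕ → ℕ → ℕ) (C : ℕ) : Prop :=
  (P 0 = 0 ∧ P n = 0) ∧
  (∀ x < n * k + n, 0 < x → (∃ i < n, 0 < i ∧ P i = x) ∨ ∃ i < n, ∃ j < k, t i j = x) ∧
  (∀ i < n, (∑ j ∈ Finset.range k, t i j) = C) ∧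
  (∀ i < n, t i 0 + P i + P (i + 1) < C ∧
    ∃ i' < n, ∃ j' < k, 0 < j' ∧ t i' j' = t i 0 + P i + P (i + 1)) ∧
  (∀ i < n - 1, t i 0 + P i + P (i + 1) ≠ t (i + 1) 0 + P (i + 1) + P (i + 2))

lemma Strong.good {n k P t C} (h : Strong n k P t C) : Good n k P t C := by
  obtain ⟨h1, h2, h3, h4, h5⟩ := h
  refine ⟨h1, h2, fun i hi => Or.inl (h3 i hi), fun i hi => Or.inr (h4 i hi).2, ?_, h5⟩
  intro i hi
  rw [h3 i hi]
  exact (h4 i hi).1.ne'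

lemma Strong.step {n k P t C} (hk : 1 ≤ k) (h : Strong n k P t C) :
    ∃ P t C, Strong n (k + 2) P t C := by
  obtain ⟨h1, h2, h3, h4, h5⟩ := h
  have hlt : ∀ i j, j < k → (if j < k then t i j else if j = k then n * k + n + i
      else n * k + 3 * n - 1 - i) = t i j := fun i j hj => if_pos hj
  refine ⟨P, fun i j => if j < k then t i j else if j = k then n * k + n + i
    else n * k + 3 * n - 1 - i, C + (2 * (n * k) + 4 * n - 1), h1, ?_, ?_, ?_, ?_⟩
  · intro x hx hx0
    by_cases hx1 : x < n * k + n
    · rcases h2 x hx1 hx0 with h | ⟨i, hi, j, hj, hh⟩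
      · exact Or.inl h
      · refine Or.inr ⟨i, hi, j, by omega, ?_⟩
        exact (hlt i j hj).trans hh
    · right
      rw [mul_add] at hx
      by_cases hx2 : x < n * k + 2 * n
      · refine ⟨x - (n * k + n), by omega, k, by omega, ?_⟩
        simp
        omega
      · refine ⟨n * k + 3 * n - 1 - x, by omega, k + 1, by omega, ?_⟩
        simp
        omega
  · intro i hi
    rw [Finset.sum_range_succ, Finset.sum_range_succ, Finset.sum_congr rfl
      (fun j hj => hlt i j (Finset.mem_range.1 hj)), h3 i hi]
    simp
    omega
  · intro i hi
    obtain ⟨ha, i', hi', j', hj', hj0, hh⟩ := h4 i hi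
    simp only [hlt i 0 hk]
    refine ⟨by omega, i', hi', j', by omega, hj0, ?_⟩
    exact (hlt i' j' hj').trans hh
  · intro i hi
    simp only [hlt _ 0 hk]
    exact h5 i hi

lemma strong_add {n k P t C} (hk : 1 ≤ k) (h : Strong n k P t C) (r : ℕ) :
    ∃ P t C, Strong n (k + 2 * r) P t C := by
  induction r with
  | zero => exact ⟨P, t, C, h⟩
  | succ r ih =>
    obtain ⟨P, t, C, h⟩ := ih
    exact Strong.step (k := k + 2 * r) (by omega) h

lemma good_22 : Good 2 2 (fun i => [0, 4, 0].getD i 0)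
    (fun i j => ([[2, 3], [1, 5]].getD i []).getD j 0) 6 := by
  unfold Good; decide

lemma good_32 : Good 3 2 (fun i => [0, 5, 4, 0].getD i 0)
    (fun i j => ([[2, 8], [1, 6], [3, 7]].getD i []).getD j 0) 10 := by
  unfold Good; decide

lemma strong_23 : Strong 2 3 (fun i => [0, 2, 0].getD i 0)
    (fun i j => ([[1, 5, 7], [4, 3, 6]].getD i []).getD j 0) 13 := by
  unfold Strong; decide

lemma strong_24 : Strong 2 4 (fun i => [0, 1, 0].getD i 0)
    (fun i j => ([[2, 3, 8, 9], [4, 5, 6, 7]].getD i []).getD j 0) 22 := by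
  unfold Strong; decide

lemma strong_33 : Strong 3 3 (fun i => [0, 1, 2, 0].getD i 0)
    (fun i j => ([[3, 7, 11], [5, 6, 10], [9, 4, 8]].getD i []).getD j 0) 21 := by
  unfold Strong; decide

lemma strong_34 : Strong 3 4 (fun i => [0, 1, 2, 0].getD i 0)
    (fun i j => ([[3, 4, 13, 14], [5, 6, 11, 12], [7, 8, 9, 10]].getD i []).getD j 0) 34 := by
  unfold Strong; decide

lemma strong_42 : Strong 4 2 (fun i => [0, 1, 2, 3, 0].getD i 0)
    (fun i j => ([[6, 9], [8, 7], [5, 10], [4, 11]].getD i []).getD j 0) 15 := by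
  unfold Strong; decide

lemma strong_43 : Strong 4 3 (fun i => [0, 1, 2, 5, 0].getD i 0)
    (fun i j => ([[3, 11, 14], [7, 8, 13], [6, 10, 12], [9, 4, 15]].getD i []).getD j 0) 28 := by
  unfold Strong; decide

/-- Path labels. -/
def pA (n i : ℕ) : ℕ := if i < n then i else 0

/-- Spoke labels. -/
def sA (n i : ℕ) : ℕ := if i = n - 3 then n else if i = n - 1 then n + 2 else 2 * n - 1 - i

lemma sA_range (n i : ℕ) (hn : 5 ≤ n) (hi : i < n) : n ≤ sA n i ∧ sA n i < 2 * n := by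
  unfold sA
  split_ifs <;> omega

lemma sA_surj (n x : ℕ) (hn : 5 ≤ n) (hx : n ≤ x) (hx' : x < 2 * n) : ∃ i < n, sA n i = x := by
  unfold sA
  by_cases h1 : x = n
  · exact ⟨n - 3, by omega, by simp [h1]⟩
  by_cases h2 : x = n + 2
  · exact ⟨n - 1, by omega, by rw [if_neg (by omega), if_pos rfl, h2]⟩
  · exact ⟨2 * n - 1 - x, by omega, by rw [if_neg (by omega), if_neg (by omega)]; omega⟩

lemma vA_range (n i : ℕ) (hn : 5 ≤ n) (hi : i < n) :
    2 * n ≤ sA n i + pA n i + pA n (i + 1) ∧ sA n i + pA n i + pA n (i + 1) < 3 * n := by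
  unfold sA pA
  split_ifs <;> omega

lemma vA_ne (n i : ℕ) (hn : 5 ≤ n) (hi : i < n - 1) :
    sA n i + pA n i + pA n (i + 1) ≠ sA n (i + 1) + pA n (i + 1) + pA n (i + 2) := by
  unfold sA pA
  split_ifs <;> omega

lemma strong_n2 (n : ℕ) (hn : 5 ≤ n) :
    Strong n 2 (pA n) (fun i j => if j = 0 then sA n i else 4 * n - 1 - sA n i) (4 * n - 1) := by
  have hq : ∀ x, 2 * n ≤ x → x < 3 * n → ∃ i < n, 4 * n - 1 - sA n i = x := by
    intro x h1 h2
    obtain ⟨i, hi, h⟩ := sA_surj n (4 * n - 1 - x) hn (by omega) (by omega)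
    exact ⟨i, hi, by omega⟩
  refine ⟨by simp [pA], ?_, ?_, ?_, ?_⟩
  · intro x hx hx0
    by_cases h1 : x < n
    · exact Or.inl ⟨x, h1, hx0, by simp [pA, h1]⟩
    right
    by_cases h2 : x < 2 * n
    · obtain ⟨i, hi, h⟩ := sA_surj n x hn (by omega) h2
      exact ⟨i, hi, 0, by omega, by simpa using h⟩
    · obtain ⟨i, hi, h⟩ := hq x (by omega) (by omega)
      exact ⟨i, hi, 1, by omega, by simpa using h⟩
  · intro i hi
    have := sA_range n i hn hi
    simp [Finset.sum_range_succ]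
    omega
  · intro i hi
    have := vA_range n i hn hi
    simp only [if_true]
    refine ⟨by omega, ?_⟩
    obtain ⟨i', hi', h⟩ := hq _ this.1 this.2
    exact ⟨i', hi', 1, by omega, by omega, by simpa using h⟩
  · intro i hi
    simpa using vA_ne n i hn hi

/-- Second row of the magic rectangle with three rows and `2 * h + 1` columns. -/
def mB (h a : ℕ) : ℕ := if a % 2 = 0 then h - a / 2 else 2 * h - a / 2

lemma mB_range (h a : ℕ) (ha : a ≤ 2 * h) :
    mB h a ≤ 2 * h ∧ a + mB h a ≤ 3 * h ∧ h ≤ a + mB h a := by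
  unfold mB
  split_ifs <;> omega

lemma mB_surj (h y : ℕ) (hy : y ≤ 2 * h) : ∃ a ≤ 2 * h, mB h a = y := by
  unfold mB
  by_cases h1 : y ≤ h
  · exact ⟨2 * (h - y), by omega, by rw [if_pos (by omega)]; omega⟩
  · exact ⟨2 * (2 * h - y) + 1, by omega, by rw [if_neg (by omega)]; omega⟩

lemma mC_surj (h y : ℕ) (hy : y ≤ 2 * h) : ∃ a ≤ 2 * h, 3 * h - a - mB h a = y := by
  unfold mB
  by_cases h1 : h ≤ y
  · exact ⟨2 * (2 * h - y), by omega, by rw [if_pos (by omega)]; omega⟩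
  · exact ⟨2 * (h - 1 - y) + 1, by omega, by rw [if_neg (by omega)]; omega⟩

lemma strong_odd3 (n h : ℕ) (hn : 5 ≤ n) (hh : n = 2 * h + 1) :
    Strong n 3 (pA n) (fun i j => if j = 0 then sA n i else if j = 1 then
      2 * n + mB h (sA n i - n) else 3 * n + (3 * h - (sA n i - n) - mB h (sA n i - n)))
      (6 * n + 3 * h) := by
  have hq : ∀ x, 2 * n ≤ x → x < 3 * n → ∃ i < n, 2 * n + mB h (sA n i - n) = x := by
    intro x h1 h2
    obtain ⟨a, ha, h3⟩ := mB_surj h (x - 2 * n) (by omega)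
    obtain ⟨i, hi, h4⟩ := sA_surj n (n + a) hn (by omega) (by omega)
    refine ⟨i, hi, ?_⟩
    rw [h4, Nat.add_sub_cancel_left]
    omega
  have hr : ∀ x, 3 * n ≤ x → x < 4 * n →
      ∃ i < n, 3 * n + (3 * h - (sA n i - n) - mB h (sA n i - n)) = x := by
    intro x h1 h2
    obtain ⟨a, ha, h3⟩ := mC_surj h (x - 3 * n) (by omega)
    obtain ⟨i, hi, h4⟩ := sA_surj n (n + a) hn (by omega) (by omega)
    refine ⟨i, hi, ?_⟩
    rw [h4, Nat.add_sub_cancel_left]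
    omega
  refine ⟨by simp [pA], ?_, ?_, ?_, ?_⟩
  · intro x hx hx0
    by_cases h1 : x < n
    · exact Or.inl ⟨x, h1, hx0, by simp [pA, h1]⟩
    right
    by_cases h2 : x < 2 * n
    · obtain ⟨i, hi, h⟩ := sA_surj n x hn (by omega) h2
      exact ⟨i, hi, 0, by omega, by simpa using h⟩
    by_cases h3 : x < 3 * n
    · obtain ⟨i, hi, h⟩ := hq x (by omega) (by omega)
      exact ⟨i, hi, 1, by omega, by simpa using h⟩
    · obtain ⟨i, hi, h⟩ := hr x (by omega) (by omega)
      exact ⟨i, hi, 2, by omega, by simpa using h⟩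
  · intro i hi
    have := sA_range n i hn hi
    have := mB_range h (sA n i - n) (by omega)
    simp [Finset.sum_range_succ]
    omega
  · intro i hi
    have := vA_range n i hn hi
    simp only [if_true]
    refine ⟨by omega, ?_⟩
    obtain ⟨i', hi', h⟩ := hq _ this.1 this.2
    exact ⟨i', hi', 1, by omega, by omega, by simpa using h⟩
  · intro i hi
    simpa using vA_ne n i hn hi

/-- Path labels, `n = 2 * h + 2`. -/
def pE (h i : ℕ) : ℕ := if i < h + 1 then i else if i < 2 * h + 2 then i + 1 else 0

/-- Spoke labels, `n = 2 * h + 2`. -/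
def sE (h i : ℕ) : ℕ :=
  if i = 2 * h then h + 1 else if i = 2 * h + 1 then 2 * h + 3 else 4 * h + 3 - i

lemma sE_range (h i : ℕ) (hn : 2 ≤ h) (hi : i < 2 * h + 2) (hi' : i ≠ 2 * h) :
    2 * h + 3 ≤ sE h i ∧ sE h i ≤ 4 * h + 3 := by
  unfold sE
  split_ifs <;> omega

lemma sE_surj (h x : ℕ) (hn : 2 ≤ h) (hx : 2 * h + 3 ≤ x) (hx' : x ≤ 4 * h + 3) :
    ∃ i < 2 * h + 2, i ≠ 2 * h ∧ sE h i = x := by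
  unfold sE
  by_cases h1 : x = 2 * h + 3
  · exact ⟨2 * h + 1, by omega, by omega, by simp [h1]⟩
  · exact ⟨4 * h + 3 - x, by omega, by omega,
      by rw [if_neg (by omega), if_neg (by omega)]; omega⟩

lemma vE_range (h i : ℕ) (hn : 2 ≤ h) (hi : i < 2 * h + 2) :
    4 * h + 4 ≤ sE h i + pE h i + pE h (i + 1) ∧
      sE h i + pE h i + pE h (i + 1) < 8 * h + 8 := by
  unfold sE pE
  split_ifs <;> omega

lemma vE_ne (h i : ℕ) (hn : 2 ≤ h) (hi : i < 2 * h + 2 - 1) :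
    sE h i + pE h i + pE h (i + 1) ≠ sE h (i + 1) + pE h (i + 1) + pE h (i + 2) := by
  unfold sE pE
  split_ifs <;> omega

/-- Star labels, `n = 2 * h + 2`. -/
def tE (h i j : ℕ) : ℕ :=
  if j = 0 then sE h i
  else if j = 1 then
    if i = 2 * h then 6 * h + 5 else 4 * h + 4 + mB h (sE h i - (2 * h + 3))
  else
    if i = 2 * h then 8 * h + 7 else
      6 * h + 6 + (3 * h - (sE h i - (2 * h + 3)) - mB h (sE h i - (2 * h + 3)))

lemma strong_even3 (h : ℕ) (hn : 2 ≤ h) :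
    Strong (2 * h + 2) 3 (pE h) (tE h) (15 * h + 13) := by
  have hq : ∀ x, 4 * h + 4 ≤ x → x < 8 * h + 8 →
      ∃ i < 2 * h + 2, ∃ j < 3, 0 < j ∧ tE h i j = x := by
    intro x h1 h2
    by_cases e1 : x = 6 * h + 5
    · exact ⟨2 * h, by omega, 1, by omega, by omega, by simp [tE, e1]⟩
    by_cases e2 : x = 8 * h + 7
    · exact ⟨2 * h, by omega, 2, by omega, by omega, by simp [tE, e2]⟩
    by_cases e3 : x < 6 * h + 5
    · obtain ⟨a, ha, h3⟩ := mB_surj h (x - (4 * h + 4)) (by omega)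
      obtain ⟨i, hi, hne, h4⟩ := sE_surj h (2 * h + 3 + a) hn (by omega) (by omega)
      refine ⟨i, hi, 1, by omega, by omega, ?_⟩
      simp only [tE, h4, Nat.add_sub_cancel_left, if_neg hne]
      simp
      omega
    · obtain ⟨a, ha, h3⟩ := mC_surj h (x - (6 * h + 6)) (by omega)
      obtain ⟨i, hi, hne, h4⟩ := sE_surj h (2 * h + 3 + a) hn (by omega) (by omega)
      refine ⟨i, hi, 2, by omega, by omega, ?_⟩
      simp only [tE, h4, Nat.add_sub_cancel_left, if_neg hne]
      simp
      omega
  refine ⟨⟨by simp [pE], by rw [pE, if_neg (by omega), if_neg (by omega)]⟩, ?_, ?_, ?_, ?_⟩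
  · intro x hx hx0
    by_cases h0 : x = h + 1
    · exact Or.inr ⟨2 * h, by omega, 0, by omega, by simp [tE, sE, h0]⟩
    by_cases h1 : x < h + 1
    · exact Or.inl ⟨x, by omega, hx0, by simp [pE, h1]⟩
    by_cases h2 : x < 2 * h + 3
    · refine Or.inl ⟨x - 1, by omega, by omega, ?_⟩
      rw [pE, if_neg (by omega), if_pos (by omega)]
      omega
    right
    by_cases h3 : x < 4 * h + 4
    · obtain ⟨i, hi, _, h⟩ := sE_surj h x hn (by omega) (by omega)
      exact ⟨i, hi, 0, by omega, by simpa [tE] using h⟩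
    · obtain ⟨i, hi, j, hj, _, h⟩ := hq x (by omega) (by omega)
      exact ⟨i, hi, j, hj, h⟩
  · intro i hi
    by_cases hi' : i = 2 * h
    · simp [Finset.sum_range_succ, tE, hi', sE]
      omega
    · have := sE_range h i hn hi hi'
      have := mB_range h (sE h i - (2 * h + 3)) (by omega)
      simp [Finset.sum_range_succ, tE, hi']
      omega
  · intro i hi
    have := vE_range h i hn hi
    have e : tE h i 0 = sE h i := by simp [tE]
    rw [e]
    exact ⟨by omega, hq _ this.1 this.2⟩
  · intro i hi
    simpa [tE] using vE_ne h i hn hi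

lemma strong_of_base {n k k₀ : ℕ} {P t C} (h : Strong n k₀ P t C) (h0 : 1 ≤ k₀) (hk : k₀ ≤ k)
    (hp : k % 2 = k₀ % 2) : ∃ P t C, Good n k P t C := by
  obtain ⟨P, t, C, h⟩ := strong_add h0 h ((k - k₀) / 2)
  have e : k₀ + 2 * ((k - k₀) / 2) = k := by omega
  rw [e] at h
  exact ⟨P, t, C, h.good⟩

lemma exists_good (n k : ℕ) (hn : 2 ≤ n) (hk : 2 ≤ k) : ∃ P t C, Good n k P t C := by
  by_cases hn5 : 5 ≤ n
  · by_cases hp : k % 2 = 0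
    · exact strong_of_base (strong_n2 n hn5) (by omega) hk (by omega)
    · by_cases hq : n % 2 = 0
      · obtain ⟨h, rfl⟩ : ∃ h, n = 2 * h + 2 := ⟨n / 2 - 1, by omega⟩
        exact strong_of_base (strong_even3 h (by omega)) (by omega) (by omega) (by omega)
      · exact strong_of_base (strong_odd3 n (n / 2) hn5 (by omega)) (by omega) (by omega)
          (by omega)
  · by_cases hp : k % 2 = 0
    · obtain rfl | rfl | rfl : n = 2 ∨ n = 3 ∨ n = 4 := by omega
      · by_cases h2 : k = 2
        · subst h2
          exact ⟨_, _, _, good_22⟩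
        · exact strong_of_base strong_24 (by omega) (by omega) (by omega)
      · by_cases h2 : k = 2
        · subst h2
          exact ⟨_, _, _, good_32⟩
        · exact strong_of_base strong_34 (by omega) (by omega) (by omega)
      · exact strong_of_base strong_42 (by omega) (by omega) (by omega)
    · obtain rfl | rfl | rfl : n = 2 ∨ n = 3 ∨ n = 4 := by omega
      · exact strong_of_base strong_23 (by omega) (by omega) (by omega)
      · exact strong_of_base strong_33 (by omega) (by omega) (by omega)
      · exact strong_of_base strong_43 (by omega) (by omega) (by omega)

/-- For all integers `n ≥ 2` and `k ≥ 2`, the local antimagic chromatic number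
of the firecracker graph `F_{n,k}` equals `nk − n + 1`. -/
theorem chiLA_firecracker {n k : ℕ} (hn : 2 ≤ n) (hk : 2 ≤ k) :
    chiLA (firecracker n k) = n * k - n + 1 := by
  obtain ⟨P, t, C, hg⟩ := exists_good n k hn hk
  obtain ⟨N, rfl⟩ : ∃ N, n = N + 1 := ⟨n - 1, by omega⟩
  obtain ⟨K, rfl⟩ : ∃ K, k = K + 1 := ⟨k - 1, by omega⟩
  have e : (N + 1) * (K + 1) - (N + 1) + 1 = (N + 1) * K + 1 := by
    rw [mul_add, mul_one, Nat.add_sub_cancel]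
  rw [e]
  obtain ⟨f, hf, hc⟩ := upper N K (by omega) P t C hg
  unfold chiLA
  apply le_antisymm
  · refine le_trans (Nat.sInf_le ?_) hc
    exact ⟨f, hf, rfl⟩
  · refine le_csInf ?_ ?_
    · exact ⟨colorCount _ f, f, hf, rfl⟩
    rintro c ⟨g, hg, rfl⟩
    exact lower N K (by omega) g hg

end LocalAntimagic
end
end

section
/- Every tree T with at least 3 vertices and with l leaves satisfies χ_la(T) ≥ l + 1. -/
/-!
Local antimagic (total) labelings and chromatic numbers, firecracker graphs,
stars, double stars, joins, and edge-corona products.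
-/

open scoped Classical

noncomputable section

namespace LocalAntimagic

variable {V : Type*} [Fintype V]

lemma exists_lower (S : Finset ℕ) (k : ℕ) (hk : k ≤ S.card) :
    ∃ B ⊆ S, B.card = k ∧ ∀ b ∈ B, ∀ c ∈ S \ B, b < c := by
  induction k with
  | zero => exact ⟨∅, by simp, by simp, by simp⟩
  | succ k ih =>
    obtain ⟨B, hB, hc, h⟩ := ih (by omega)
    have hne : (S \ B).Nonempty := by
      rw [← Finset.card_pos, Finset.card_sdiff_of_subset hB]; omega
    have hm := Finset.min'_mem _ hne
    have hle := fun x hx => Finset.min'_le (S \ B) x hx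
    set m := (S \ B).min' hne
    refine ⟨insert m B, ?_, ?_, ?_⟩
    · intro x hx
      grind
    · rw [Finset.card_insert_of_notMem (by grind), hc]
    · intro b hb c hc'
      have hcS : c ∈ S \ B := by grind
      have hcm : c ≠ m := by grind
      have := hle c hcS
      rcases Finset.mem_insert.1 hb with rfl | hb
      · omega
      · exact h b hb c hcS

lemma exists_upper (S : Finset ℕ) (k : ℕ) (hk : k ≤ S.card) :
    ∃ B ⊆ S, B.card = k ∧ ∀ b ∈ B, ∀ c ∈ S \ B, c < b := by
  obtain ⟨B, hB, hc, h⟩ := exists_lower S (S.card - k) (by omega)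
  refine ⟨S \ B, Finset.sdiff_subset, ?_, ?_⟩
  · rw [Finset.card_sdiff_of_subset hB]; omega
  · intro b hb c hc'
    exact h c (by grind) b hb

lemma sum_lt_of_lt (C B : Finset ℕ) (hcard : C.card ≤ B.card) (hB : 0 < B.card)
    (h : ∀ b ∈ B, ∀ c ∈ C, c < b) : ∑ c ∈ C, c ≤ ∑ b ∈ B, b ∧
      ((∀ b ∈ B, 0 < b) → ∑ c ∈ C, c < ∑ b ∈ B, b) := by
  have hne : B.Nonempty := Finset.card_pos.1 hB
  have hm := Finset.min'_mem _ hne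
  have hle : B.card * B.min' hne ≤ ∑ b ∈ B, b := by
    rw [← smul_eq_mul]
    exact Finset.card_nsmul_le_sum _ _ _ fun x hx => Finset.min'_le B x hx
  set m := B.min' hne
  have h2 : ∑ c ∈ C, c ≤ C.card * (m - 1) := by
    rw [← smul_eq_mul]
    refine Finset.sum_le_card_nsmul _ _ _ fun x hx => ?_
    have := h m hm x hx
    omega
  have h3 : C.card * (m - 1) ≤ B.card * (m - 1) := Nat.mul_le_mul_right _ hcard
  have h4 : B.card * (m - 1) ≤ B.card * m := Nat.mul_le_mul_left _ (by omega)
  refine ⟨by omega, fun hp => ?_⟩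
  have h5 : B.card * (m - 1) < B.card * m :=
    Nat.mul_lt_mul_of_pos_left (by have := hp m hm; omega) hB
  omega

lemma weight_leaf_s1 (G : SimpleGraph V) (f : Sym2 V → ℕ) {a v : V} (hav : G.Adj a v)
    (h : ∀ z, G.Adj a z → z = v) : weight G f a = f s(a, v) := by
  unfold weight
  rw [Finset.sum_eq_single s(a, v)]
  · simp
  · intro e he hne
    rw [if_neg]
    intro hae
    obtain ⟨z, rfl⟩ := Sym2.mem_iff_exists.1 hae
    have : G.Adj a z := by simpa using he
    exact hne (by rw [h z this])
  · intro hn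
    exact absurd (by simpa using hav) hn

lemma lt_weight (G : SimpleGraph V) (f : Sym2 V → ℕ) {v a z : V} (hva : G.Adj v a)
    (hvz : G.Adj v z) (hne : a ≠ z) (hpos : 0 < f s(v, z)) : f s(v, a) < weight G f v := by
  have h1 : ∑ e ∈ ({s(v, a), s(v, z)} : Finset (Sym2 V)), (if v ∈ e then f e else 0)
      ≤ weight G f v := by
    unfold weight
    apply Finset.sum_le_sum_of_subset
    intro e he
    rcases Finset.mem_insert.1 he with rfl | he
    · simpa using hva
    · rw [Finset.mem_singleton] at he
      subst he
      simpa using hvz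
  rw [Finset.sum_pair (fun h => hne (Sym2.congr_right.1 h))] at h1
  simp at h1
  omega

/-- No connected component of `G` is a single edge. -/
def Nice (G : SimpleGraph V) : Prop :=
  ∀ x y, G.Adj x y → ∃ z, (z ≠ y ∧ G.Adj x z) ∨ (z ≠ x ∧ G.Adj y z)

lemma exists_leaf (H : SimpleGraph V) (hH : H.IsAcyclic) {x y : V} (hxy : H.Adj x y) :
    ∃ v u, H.Adj v u ∧ ∀ w, H.Adj v w → w = u := by
  have : Nonempty V := ⟨x⟩
  have ⟨u, v, p, hp, hmax⟩ := SimpleGraph.Walk.exists_isPath_forall_isPath_length_le_length H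
  have hnil : ¬p.Nil := by
    intro hn
    have h1 := hmax x y (SimpleGraph.Path.singleton hxy).1 (SimpleGraph.Path.singleton hxy).2
    have h2 : p.length = 0 := SimpleGraph.Walk.length_eq_zero_iff.2 hn
    simp [h2] at h1
  refine ⟨u, p.snd, p.adj_snd hnil, fun w hadj ↦ ?_⟩
  apply hH.eq_snd_of_adj_start hp hadj
  have : ¬(p.cons hadj.symm).IsPath := by
    intro hh
    have := hmax _ _ _ hh
    simp at this
  grind [hp.cons]

lemma exists_pendant (G : SimpleGraph V) (hG : G.IsAcyclic) (hN : Nice G) {x y : V}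
    (hxy : G.Adj x y) :
    ∃ v u, (∃ a b, a ≠ b ∧ G.Adj v a ∧ G.Adj v b) ∧
      ∀ y, G.Adj v y → (∀ z, G.Adj y z → z = v) ∨ y = u := by
  let NL : V → Prop := fun v => ∃ a b, a ≠ b ∧ G.Adj v a ∧ G.Adj v b
  let H : SimpleGraph V :=
    { Adj := fun a b => G.Adj a b ∧ NL a ∧ NL b
      symm := ⟨fun a b h => ⟨h.1.symm, h.2.2, h.2.1⟩⟩
      loopless := ⟨fun a h => G.loopless.irrefl a h.1⟩ }
  have hle : H ≤ G := fun a b h => h.1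
  have key : ∀ v w, G.Adj v w → ¬ NL w → ∀ z, G.Adj w z → z = v := by
    intro v w hvw hw z hz
    by_contra hne
    exact hw ⟨z, v, hne, hz, hvw.symm⟩
  by_cases hH : ∃ a b, H.Adj a b
  · obtain ⟨a, b, hab⟩ := hH
    obtain ⟨v, u, hvu, huniq⟩ := exists_leaf H (hG.anti hle) hab
    refine ⟨v, u, hvu.2.1, fun w hw => ?_⟩
    by_cases hwn : NL w
    · exact Or.inr (huniq w ⟨hw, hvu.2.1, hwn⟩)
    · exact Or.inl (key v w hw hwn)
  · have main : ∀ v, NL v → ∃ v u, (∃ a b, a ≠ b ∧ G.Adj v a ∧ G.Adj v b) ∧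
      ∀ y, G.Adj v y → (∀ z, G.Adj y z → z = v) ∨ y = u := by
      intro v hv
      refine ⟨v, v, hv, fun w hw => Or.inl (key v w hw fun hwn => hH ⟨v, w, hw, hv, hwn⟩)⟩
    obtain ⟨z, ⟨hz, hxz⟩ | ⟨hz, hyz⟩⟩ := hN x y hxy
    · exact main x ⟨z, y, hz, hxz, hxy⟩
    · exact main y ⟨z, x, hz, hyz, hxy.symm⟩

lemma exists_labeling (n : ℕ) : ∀ (G : SimpleGraph V), G.IsAcyclic → Nice G →
    ∀ S : Finset ℕ, (∀ s ∈ S, 0 < s) → S.card = G.edgeFinset.card → G.edgeFinset.card = n →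
    ∃ f : Sym2 V → ℕ, Set.BijOn f G.edgeSet S ∧
      ∀ u v, G.Adj u v → weight G f u ≠ weight G f v := by
  induction n using Nat.strong_induction_on with
  | _ n ih =>
  intro G hG hN S hS hcard hn
  by_cases hE : ∃ x y, G.Adj x y
  swap
  · push Not at hE
    have h0 : G.edgeFinset = ∅ := by
      ext e
      induction e with
      | _ x y => simp [hE]
    have h1 : G.edgeSet = ∅ := by
      ext e
      induction e with
      | _ x y => simp [hE]
    have hS0 : S = ∅ := by rw [← Finset.card_eq_zero, hcard, h0]; rfl
    refine ⟨fun _ => 0, ?_, fun u v h => absurd h (hE u v)⟩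
    rw [h1, hS0]
    simp
  obtain ⟨x, y, hxy⟩ := hE
  obtain ⟨v, u, ⟨p, q, hpq, hvp, hvq⟩, hvu⟩ := exists_pendant G hG hN hxy
  -- leaf neighbours of `v`
  let A : V → Prop := fun a => G.Adj v a ∧ ∀ z, G.Adj a z → z = v
  let D : Finset (Sym2 V) := G.edgeFinset.filter fun e => ∃ a, A a ∧ e = s(v, a)
  have hDE : D ⊆ G.edgeFinset := Finset.filter_subset _ _
  have memD : ∀ e, e ∈ D ↔ ∃ a, A a ∧ e = s(v, a) := by
    intro e
    simp only [D, Finset.mem_filter]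
    refine ⟨fun h => h.2, fun h => ⟨?_, h⟩⟩
    obtain ⟨a, ha, rfl⟩ := h
    simpa using ha.1
  have hvA : ¬ A v := fun h => G.loopless.irrefl v h.1
  have hDpos : 0 < D.card := by
    rw [Finset.card_pos]
    have : A p ∨ A q := by
      rcases hvu p hvp with h | h
      · exact Or.inl ⟨hvp, h⟩
      · rcases hvu q hvq with h' | h'
        · exact Or.inr ⟨hvq, h'⟩
        · exact absurd (h.trans h'.symm) hpq
    rcases this with h | h
    · exact ⟨_, (memD _).2 ⟨p, h, rfl⟩⟩
    · exact ⟨_, (memD _).2 ⟨q, h, rfl⟩⟩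
  obtain ⟨G', hG'⟩ : ∃ G' : SimpleGraph V, G' = G.deleteEdges (D : Set (Sym2 V)) := ⟨_, rfl⟩
  have adj' : ∀ a b, G'.Adj a b ↔ G.Adj a b ∧ s(a, b) ∉ D := by
    intro a b; simp [hG', SimpleGraph.deleteEdges_adj]
  have hE' : G'.edgeFinset = G.edgeFinset \ D := by
    ext e
    induction e with
    | _ a b =>
      simp only [SimpleGraph.mem_edgeFinset, Finset.mem_sdiff, SimpleGraph.mem_edgeSet, adj']
  have hEs' : G'.edgeSet = G.edgeSet \ (D : Set (Sym2 V)) := by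
    simp [hG', SimpleGraph.edgeSet_deleteEdges]
  have notA : ∀ a b, G'.Adj a b → ¬ A a := by
    intro a b hab ha
    have h1 := (adj' a b).1 hab
    have h2 := ha.2 b h1.1
    subst h2
    exact h1.2 ((memD _).2 ⟨a, ha, Sym2.eq_swap⟩)
  have toG' : ∀ a b, G.Adj a b → ¬ A a → ¬ A b → G'.Adj a b := by
    intro a b hab ha hb
    refine (adj' a b).2 ⟨hab, fun h => ?_⟩
    obtain ⟨c, hc, hce⟩ := (memD _).1 h
    rcases Sym2.eq_iff.1 hce with ⟨h1, h2⟩ | ⟨h1, h2⟩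
    · exact hb (h2 ▸ hc)
    · exact ha (h1 ▸ hc)
  have keep : ∀ a b, G.Adj a b → ¬ A a → a ≠ v → G'.Adj a b := by
    intro a b hab ha hav
    exact toG' a b hab ha fun hb => hav (hb.2 a hab.symm)
  have vadj : ∀ w, G'.Adj v w → w = u := by
    intro w hw
    rcases hvu w ((adj' _ _).1 hw).1 with h | h
    · exact absurd ⟨((adj' _ _).1 hw).1, h⟩ (notA w v hw.symm)
    · exact h
  have hN' : Nice G' := by
    have hv : ∀ w, G'.Adj v w → ∃ z, z ≠ v ∧ G'.Adj w z := by
      intro w hw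
      have hwA := notA w v hw.symm
      have : ∃ z, G.Adj w z ∧ z ≠ v := by
        by_contra hcon
        push Not at hcon
        exact hwA ⟨((adj' _ _).1 hw).1, hcon⟩
      obtain ⟨z, hz, hzv⟩ := this
      exact ⟨z, hzv, keep w z hz hwA hw.ne'⟩
    intro a b hab
    by_cases hav : a = v
    · subst hav
      obtain ⟨z, h1, h2⟩ := hv b hab
      exact ⟨z, Or.inr ⟨h1, h2⟩⟩
    by_cases hbv : b = v
    · subst hbv
      obtain ⟨z, h1, h2⟩ := hv a hab.symm
      exact ⟨z, Or.inl ⟨h1, h2⟩⟩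
    obtain ⟨z, ⟨h1, h2⟩ | ⟨h1, h2⟩⟩ := hN a b ((adj' _ _).1 hab).1
    · exact ⟨z, Or.inl ⟨h1, keep _ _ h2 (notA _ _ hab) hav⟩⟩
    · exact ⟨z, Or.inr ⟨h1, keep _ _ h2 (notA _ _ hab.symm) hbv⟩⟩
  let F : Finset (Sym2 V) := (G'.edgeFinset.filter fun e => u ∈ e).erase s(v, u)
  have hcardD : D.card ≤ S.card := hcard ▸ Finset.card_le_card hDE
  -- choice of the labels used at the leaves
  obtain ⟨B, hBS, hBc, hB⟩ : ∃ B ⊆ S, B.card = D.card ∧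
      ∀ C ⊆ S \ B, C.card = F.card → ∑ c ∈ C, c ≠ ∑ b ∈ B, b := by
    rcases le_total F.card D.card with hle | hle
    · obtain ⟨B, h1, h2, h3⟩ := exists_upper S D.card hcardD
      refine ⟨B, h1, h2, fun C hC hCc => ne_of_lt ?_⟩
      exact (sum_lt_of_lt C B (by omega) (by omega) fun b hb c hc => h3 b hb c (hC hc)).2
        fun b hb => hS b (h1 hb)
    · obtain ⟨B, h1, h2, h3⟩ := exists_lower S D.card hcardD
      refine ⟨B, h1, h2, fun C hC hCc => ne_of_gt ?_⟩
      exact (sum_lt_of_lt B C (by omega) (by omega) fun c hc b hb => h3 b hb c (hC hc)).2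
        fun c hc => hS c (Finset.mem_sdiff.1 (hC hc)).1
  have hcE' : G'.edgeFinset.card = G.edgeFinset.card - D.card := by
    rw [hE', Finset.card_sdiff_of_subset hDE]
  obtain ⟨f', hf', hw'⟩ := ih G'.edgeFinset.card (by omega) G'
    (hG.anti (hG' ▸ SimpleGraph.deleteEdges_le _)) hN' (S \ B)
    (fun s hs => hS s (Finset.mem_sdiff.1 hs).1)
    (by rw [Finset.card_sdiff_of_subset hBS, hBc, hcard, ← hcE']) rfl
  let g : D ≃ B := Finset.equivOfCardEq hBc.symm
  let f : Sym2 V → ℕ := fun e => if h : e ∈ D then (g ⟨e, h⟩ : ℕ) else f' e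
  have fD : ∀ e (h : e ∈ D), f e = g ⟨e, h⟩ := fun e h => by simp [f, h]
  have fE : ∀ e, e ∉ D → f e = f' e := fun e h => by simp [f, h]
  have bijD : Set.BijOn f D B := by
    refine ⟨fun e he => ?_, fun e he e' he' hee => ?_, fun b hb => ?_⟩
    · rw [fD e he]; exact (g ⟨e, he⟩).2
    · rw [fD e he, fD e' he'] at hee
      simpa using g.injective (Subtype.ext hee)
    · refine ⟨(g.symm ⟨b, hb⟩ : D), (g.symm ⟨b, hb⟩).2, ?_⟩
      rw [fD _ (g.symm ⟨b, hb⟩).2]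
      simp
  have bijE : Set.BijOn f G'.edgeSet (S \ B : Finset ℕ) := by
    refine hf'.congr fun e he => ?_
    rw [hEs'] at he
    exact (fE e he.2).symm
  have bij : Set.BijOn f G.edgeSet S := by
    have hu := bijD.union bijE ?_
    · convert hu using 1
      · rw [hEs', Set.union_diff_cancel]
        intro e he
        simpa using hDE he
      · rw [← Finset.coe_union, Finset.union_sdiff_of_subset hBS]
    · rw [Set.injOn_union]
      · refine ⟨bijD.injOn, bijE.injOn, fun a ha b hb hab => ?_⟩
        have h1 := bijD.mapsTo ha
        have h2 := bijE.mapsTo hb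
        rw [← hab] at h2
        exact (Finset.mem_sdiff.1 (Finset.mem_coe.1 h2)).2 h1
      · rw [hEs']
        exact Set.disjoint_sdiff_right
  have fpos : ∀ a b, G.Adj a b → 0 < f s(a, b) := fun a b hab =>
    hS _ (bij.mapsTo (by simpa using hab))
  have split : ∀ x, weight G f x = weight G' f' x + ∑ e ∈ D, if x ∈ e then f e else 0 := by
    intro x
    unfold weight
    rw [← Finset.sum_sdiff hDE, ← hE']
    congr 1
    refine Finset.sum_congr rfl fun e he => ?_
    rw [hE', Finset.mem_sdiff] at he
    rw [fE e he.2]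
  have wother : ∀ x, ¬ A x → x ≠ v → weight G f x = weight G' f' x := by
    intro x hxA hxv
    rw [split, Finset.sum_eq_zero, add_zero]
    intro e he
    obtain ⟨a, ha, rfl⟩ := (memD e).1 he
    rw [if_neg]
    intro hx
    rcases Sym2.mem_iff.1 hx with h | h
    · exact hxv h
    · exact hxA (h ▸ ha)
  have wv : weight G f v = weight G' f' v + ∑ b ∈ B, b := by
    rw [split]
    congr 1
    have himg : B = D.image f := by
      apply Finset.coe_injective
      rw [Finset.coe_image]
      exact bijD.image_eq.symm
    rw [himg, Finset.sum_image bijD.injOn]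
    refine Finset.sum_congr rfl fun e he => ?_
    obtain ⟨a, ha, rfl⟩ := (memD e).1 he
    simp
  have cleaf : ∀ a, A a → weight G f a ≠ weight G f v := by
    intro a ha
    rw [weight_leaf_s1 G f ha.1.symm ha.2, Sym2.eq_swap]
    obtain ⟨z, hz, haz⟩ : ∃ z, G.Adj v z ∧ a ≠ z := by
      by_cases hap : a = p
      · exact ⟨q, hvq, hap ▸ hpq⟩
      · exact ⟨p, hvp, hap⟩
    exact (lt_weight G f ha.1 hz haz (fpos _ _ hz)).ne
  have cv : ∀ w, G'.Adj v w → weight G f w ≠ weight G f v := by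
    intro w hw heq
    have hwu := vadj w hw
    subst hwu
    rw [wother w (notA w v hw.symm) hw.ne', wv, weight_leaf_s1 G' f' hw vadj] at heq
    have h1 : weight G' f' w = f' s(v, w) + ∑ e ∈ F, f' e := by
      unfold weight
      rw [← Finset.sum_filter, Finset.add_sum_erase]
      simpa using hw
    have hFsub : (F : Set (Sym2 V)) ⊆ G'.edgeSet := by
      intro e he
      have := (Finset.mem_filter.1 (Finset.mem_erase.1 (Finset.mem_coe.1 he)).2).1
      simpa using this
    have hinj : Set.InjOn f' F := hf'.injOn.mono hFsub
    refine hB (F.image f') ?_ (Finset.card_image_of_injOn hinj) ?_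
    · intro c hc
      obtain ⟨e, he, rfl⟩ := Finset.mem_image.1 hc
      exact hf'.mapsTo (hFsub he)
    · rw [Finset.sum_image hinj]
      omega
  refine ⟨f, bij, fun a b hab => ?_⟩
  by_cases haA : A a
  · have := haA.2 b hab
    subst this
    exact cleaf a haA
  by_cases hbA : A b
  · have := hbA.2 a hab.symm
    subst this
    exact (cleaf b hbA).symm
  have hab' := toG' a b hab haA hbA
  by_cases hav : a = v
  · subst hav
    exact (cv b hab').symm
  by_cases hbv : b = v
  · subst hbv
    exact cv a hab'.symm
  rw [wother a haA hav, wother b hbA hbv]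
  exact hw' a b hab'

lemma nice_of_tree (G : SimpleGraph V) (hT : G.IsTree) (hcard : 3 ≤ Fintype.card V) :
    Nice G := by
  intro x y hxy
  by_contra hcon
  push Not at hcon
  have hx : ∀ z, G.Adj x z → z = y := fun z hz => by
    by_contra hne
    exact (hcon z).1 hne hz
  have hy : ∀ z, G.Adj y z → z = x := fun z hz => by
    by_contra hne
    exact (hcon z).2 hne hz
  have hall : ∀ a b, G.Walk a b → (a = x ∨ a = y) → (b = x ∨ b = y) := by
    intro a b p
    induction p with
    | nil => exact id
    | cons h p ih =>
      rintro (rfl | rfl)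
      · exact ih (Or.inr (hx _ h))
      · exact ih (Or.inl (hy _ h))
  have : (Finset.univ : Finset V) ⊆ {x, y} := by
    intro z _
    obtain ⟨p⟩ := hT.connected.preconnected x z
    simpa using hall x z p (Or.inl rfl)
  have h2 := (Finset.card_le_card this).trans Finset.card_le_two
  rw [Finset.card_univ] at h2
  omega

/-- Every tree `T` with at least 3 vertices and with `l` leaves satisfies
`χ_la(T) ≥ l + 1`. -/
theorem chiLA_tree_ge_leaves_add_one (G : SimpleGraph V) (hT : G.IsTree)
    (hcard : 3 ≤ Fintype.card V) (l : ℕ)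
    (hl : (Finset.univ.filter fun v => G.degree v = 1).card = l) :
    l + 1 ≤ chiLA G := by
  subst hl
  have hN := nice_of_tree G hT hcard
  apply le_csInf
  · obtain ⟨f, hf, hw⟩ := exists_labeling G.edgeFinset.card G hT.isAcyclic hN
      (Finset.Icc 1 G.edgeFinset.card) (fun s hs => (Finset.mem_Icc.1 hs).1) (by simp) rfl
    refine ⟨_, f, ⟨?_, hw⟩, rfl⟩
    simpa using hf
  · rintro c ⟨f, ⟨hf, hw⟩, rfl⟩
    set L := Finset.univ.filter fun v => G.degree v = 1 with hL
    have hleaf : ∀ a ∈ L, ∃ v, G.Adj a v ∧ weight G f a = f s(a, v) ∧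
        ∀ z, G.Adj a z → z = v := by
      intro a ha
      have h1 : G.degree a = 1 := (Finset.mem_filter.1 ha).2
      obtain ⟨v, hv, huniq⟩ := SimpleGraph.degree_eq_one_iff_existsUnique_adj.1 h1
      exact ⟨v, hv, weight_leaf_s1 G f hv huniq, huniq⟩
    have hinj : Set.InjOn (weight G f) L := by
      intro a ha b hb hab
      obtain ⟨v, hv, hwv, hvu⟩ := hleaf a ha
      obtain ⟨w, hw', hww, hwu⟩ := hleaf b hb
      rw [hwv, hww] at hab
      have := hf.injOn (by simpa using hv) (by simpa using hw') hab
      rcases Sym2.eq_iff.1 this with ⟨h1, _⟩ | ⟨h1, h2⟩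
      · exact h1
      · subst h1 h2
        exfalso
        obtain ⟨z, ⟨hz, hz'⟩ | ⟨hz, hz'⟩⟩ := hN _ _ hv
        · exact hz (hvu z hz')
        · exact hz (hwu z hz')
    have hne : 1 ≤ G.edgeFinset.card := by
      have := hT.card_edgeFinset
      have h3 : G.edgeFinset.card + 1 = Fintype.card V := by convert this
      omega
    obtain ⟨e, he, hfe⟩ := hf.surjOn (Set.mem_Icc.2 ⟨hne, le_refl _⟩)
    have hpos : ∀ a b, G.Adj a b → 0 < f s(a, b) := fun a b hab =>
      (Set.mem_Icc.1 (hf.mapsTo (by simpa using hab))).1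
    have hbig : ∃ x, G.edgeFinset.card < weight G f x := by
      induction e with
      | _ x y =>
        have hxy : G.Adj x y := by simpa using he
        obtain ⟨z, ⟨hz, hz'⟩ | ⟨hz, hz'⟩⟩ := hN _ _ hxy
        · exact ⟨x, hfe ▸ lt_weight G f hxy hz' hz.symm (hpos _ _ hz')⟩
        · refine ⟨y, ?_⟩
          rw [Sym2.eq_swap] at hfe
          exact hfe ▸ lt_weight G f hxy.symm hz' hz.symm (hpos _ _ hz')
    obtain ⟨x, hx⟩ := hbig
    have hxL : weight G f x ∉ L.image (weight G f) := by
      intro h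
      obtain ⟨a, ha, hax⟩ := Finset.mem_image.1 h
      obtain ⟨v, hv, hwv, -⟩ := hleaf a ha
      have := (Set.mem_Icc.1 (hf.mapsTo (show s(a, v) ∈ G.edgeSet by simpa using hv))).2
      omega
    unfold colorCount
    rw [← Finset.card_image_of_injOn hinj, ← Finset.card_insert_of_notMem hxL]
    apply Finset.card_le_card
    intro c hc
    rcases Finset.mem_insert.1 hc with rfl | hc
    · exact Finset.mem_image_of_mem _ (Finset.mem_univ _)
    · obtain ⟨a, _, rfl⟩ := Finset.mem_image.1 hc
      exact Finset.mem_image_of_mem _ (Finset.mem_univ _)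

end LocalAntimagic
end
end

section
/- For every integer n ≥ 3, the local antimagic total chromatic number of the firecracker graph F_{n,1} equals 2. -/
/-!
Local antimagic (total) labelings and chromatic numbers, firecracker graphs,
stars, double stars, joins, and edge-corona products.
-/

open scoped Classical

noncomputable section

namespace LocalAntimagic

variable {V : Type*} [Fintype V]

/-- Edge labels: `q` on the pendant edges, `e` on the path edges. -/
def combEdgeFun {n : ℕ} (q e : ℕ → ℕ) (a b : Fin n ⊕ Fin n × Fin 1) : ℕ :=
  match a, b with
  | Sum.inl i, Sum.inr _ => q i
  | Sum.inr _, Sum.inl i => q i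
  | Sum.inr x, Sum.inr y => e (min (x.1 : ℕ) (y.1 : ℕ))
  | Sum.inl _, Sum.inl _ => 0

def combEdge {n : ℕ} (q e : ℕ → ℕ) : Sym2 (Fin n ⊕ Fin n × Fin 1) → ℕ :=
  Sym2.lift ⟨combEdgeFun q e, by
    rintro (i | x) (j | y) <;> simp [combEdgeFun, min_comm]⟩

def combVert {n : ℕ} (p s : ℕ → ℕ) : Fin n ⊕ Fin n × Fin 1 → ℕ :=
  Sum.elim (fun i => p i) (fun x => s x.1)

def pend {n : ℕ} (i : Fin n) : Sym2 (Fin n ⊕ Fin n × Fin 1) := s(Sum.inl i, Sum.inr (i, 0))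

def link {n : ℕ} (i : Fin (n - 1)) : Sym2 (Fin n ⊕ Fin n × Fin 1) :=
  s(Sum.inr (⟨i, by omega⟩, 0), Sum.inr (⟨i + 1, by omega⟩, 0))

lemma combEdge_pend {n : ℕ} (q e : ℕ → ℕ) (i : Fin n) : combEdge q e (pend i) = q i := rfl

lemma combEdge_link {n : ℕ} (q e : ℕ → ℕ) (i : Fin (n - 1)) :
    combEdge (n := n) q e (link i) = e i := by
  simp [combEdge, link, combEdgeFun]

lemma pend_injective {n : ℕ} : Function.Injective (pend (n := n)) := by
  intro i j h
  simpa [pend] using h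

lemma link_injective {n : ℕ} : Function.Injective (link (n := n)) := by
  intro i j h
  simp [link] at h
  ext
  omega

lemma pend_ne_link {n : ℕ} (i : Fin n) (j : Fin (n - 1)) : pend i ≠ link j := by
  simp [pend, link]

lemma mem_edgeSet_comb {n : ℕ} (x : Sym2 (Fin n ⊕ Fin n × Fin 1)) :
    x ∈ (firecracker n 1).edgeSet ↔ (∃ i, pend i = x) ∨ (∃ i, link i = x) := by
  induction x using Sym2.ind with
  | _ a b =>
    rw [SimpleGraph.mem_edgeSet, firecracker, SimpleGraph.fromRel_adj]
    rcases a with i | ⟨i, i'⟩ <;> rcases b with j | ⟨j, j'⟩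
    · simp [pend, link]
    · simp [pend, link, Subsingleton.elim j' 0]
    · simp [pend, link, Subsingleton.elim i' 0]
    · obtain rfl := Subsingleton.elim i' 0
      obtain rfl := Subsingleton.elim j' 0
      simp only [pend, link]
      constructor
      · rintro ⟨h, h | h⟩
        · exact Or.inr ⟨⟨i, by omega⟩, by simp [Fin.ext_iff]; omega⟩
        · exact Or.inr ⟨⟨j, by omega⟩, by simp [Fin.ext_iff]; omega⟩
      · rintro (⟨k, h⟩ | ⟨k, h⟩)
        · simp at h
        · simp [Fin.ext_iff] at h ⊢
          omega

lemma edgeFinset_comb (n : ℕ) : (firecracker n 1).edgeFinset =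
    Finset.univ.image pend ∪ Finset.univ.image link := by
  ext x
  simp [mem_edgeSet_comb]

lemma disj_comb (n : ℕ) : Disjoint (Finset.univ.image (pend (n := n)))
    (Finset.univ.image (link (n := n))) := by
  rw [Finset.disjoint_left]
  intro x hx hy
  simp only [Finset.mem_image, Finset.mem_univ, true_and] at hx hy
  obtain ⟨i, rfl⟩ := hx
  obtain ⟨j, h⟩ := hy
  exact pend_ne_link _ _ h.symm

lemma card_edge_comb (n : ℕ) : (firecracker n 1).edgeFinset.card = n + (n - 1) := by
  rw [edgeFinset_comb, Finset.card_union_of_disjoint (disj_comb n),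
    Finset.card_image_of_injective _ pend_injective,
    Finset.card_image_of_injective _ link_injective]
  simp

lemma weight_comb {n : ℕ} (f : Sym2 (Fin n ⊕ Fin n × Fin 1) → ℕ) (u) :
    weight (firecracker n 1) f u =
      (∑ i : Fin n, if u ∈ pend i then f (pend i) else 0) +
      ∑ i : Fin (n - 1), if u ∈ (link i : Sym2 (Fin n ⊕ Fin n × Fin 1)) then f (link i) else 0 := by
  rw [weight, edgeFinset_comb, Finset.sum_union (disj_comb n),
    Finset.sum_image (fun _ _ _ _ h => pend_injective h),
    Finset.sum_image (fun _ _ _ _ h => link_injective h)]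
  congr!

lemma weight_inl {n : ℕ} (q e : ℕ → ℕ) (k : Fin n) :
    weight (firecracker n 1) (combEdge q e) (Sum.inl k) = q k := by
  rw [weight_comb]
  simp only [combEdge_pend, combEdge_link]
  simp [pend, link]

lemma sum_link (n : ℕ) (e : ℕ → ℕ) (k : ℕ) (hk : k < n) :
    (∑ i : Fin (n - 1), if k = i ∨ k = i + 1 then e i else 0) =
      (if 0 < k then e (k - 1) else 0) + (if k + 1 < n then e k else 0) := by
  rw [Fin.sum_univ_eq_sum_range (fun i => if k = i ∨ k = i + 1 then e i else 0) (n - 1)]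
  have : ∀ i ∈ Finset.range (n - 1), (if k = i ∨ k = i + 1 then e i else 0) =
      (if i = k - 1 then (if 0 < k then e (k - 1) else 0) else 0) + (if i = k then e k else 0) := by
    intro i hi
    by_cases h1 : i = k
    · subst h1
      by_cases h0 : i = 0
      · subst h0; simp
      · have : i ≠ i - 1 := by omega
        simp [this]
    · by_cases h2 : k = i + 1
      · subst h2; simp
      · have : ¬ (k = i ∨ k = i + 1) := by omega
        rw [if_neg this, if_neg h1]
        by_cases h3 : i = k - 1
        · have : k = 0 := by omega
          simp [this]
        · simp [h3]
  rw [Finset.sum_congr rfl this, Finset.sum_add_distrib, Finset.sum_ite_eq', Finset.sum_ite_eq']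
  simp only [Finset.mem_range]
  congr 1
  · by_cases h : 0 < k
    · have : k - 1 < n - 1 := by omega
      simp [this]
    · simp [h]
  · by_cases h : k + 1 < n
    · have : k < n - 1 := by omega
      simp [h, this]
    · have : ¬ k < n - 1 := by omega
      simp [h, this]

lemma weight_inr {n : ℕ} (q e : ℕ → ℕ) (k : Fin n) (z : Fin 1) :
    weight (firecracker n 1) (combEdge q e) (Sum.inr (k, z)) = q k +
      ((if 0 < (k : ℕ) then e (k - 1) else 0) + (if (k : ℕ) + 1 < n then e k else 0)) := by
  obtain rfl := Subsingleton.elim z 0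
  rw [weight_comb, ← sum_link n e k k.2]
  simp only [combEdge_pend, combEdge_link]
  simp [pend, link, Fin.ext_iff]
  simp [← Fin.ext_iff]

lemma two_le_count {n : ℕ} (hn : 3 ≤ n) {gv ge}
    (h : IsLocalAntimagicTotal (firecracker n 1) gv ge) :
    2 ≤ totalColorCount (firecracker n 1) gv ge := by
  have hadj : (firecracker n 1).Adj (Sum.inl ⟨0, by omega⟩) (Sum.inr (⟨0, by omega⟩, 0)) := by
    rw [← SimpleGraph.mem_edgeSet, mem_edgeSet_comb]
    exact Or.inl ⟨_, rfl⟩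
  have := h.2 _ _ hadj
  rw [totalColorCount]
  exact Finset.one_lt_card.2 ⟨_, Finset.mem_image_of_mem _ (Finset.mem_univ _), _,
    Finset.mem_image_of_mem _ (Finset.mem_univ _), this⟩

/-- Abstract criterion: a numerical labeling scheme gives `χ_lat = 2`. -/
lemma chiLAT_of_scheme {n : ℕ} (hn : 3 ≤ n) (p q s e : ℕ → ℕ) (A B : ℕ) (hAB : A ≠ B)
    (hpq : ∀ k < n, p k + q k = if k % 2 = 0 then B else A)
    (hsq : ∀ k < n, s k + (q k + ((if 0 < k then e (k - 1) else 0) +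
      (if k + 1 < n then e k else 0))) = if k % 2 = 0 then A else B)
    (rp : ∀ k < n, 1 ≤ p k ∧ p k ≤ 4 * n - 1)
    (rq : ∀ k < n, 1 ≤ q k ∧ q k ≤ 4 * n - 1)
    (rs : ∀ k < n, 1 ≤ s k ∧ s k ≤ 4 * n - 1)
    (re : ∀ k, k + 1 < n → 1 ≤ e k ∧ e k ≤ 4 * n - 1)
    (pp : ∀ k < n, ∀ l < n, p k = p l → k = l)
    (qq : ∀ k < n, ∀ l < n, q k = q l → k = l)
    (ss : ∀ k < n, ∀ l < n, s k = s l → k = l)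
    (ee : ∀ k l, k + 1 < n → l + 1 < n → e k = e l → k = l)
    (pq : ∀ k < n, ∀ l < n, p k ≠ q l)
    (ps : ∀ k < n, ∀ l < n, p k ≠ s l)
    (pe : ∀ k < n, ∀ l, l + 1 < n → p k ≠ e l)
    (qs : ∀ k < n, ∀ l < n, q k ≠ s l)
    (qe : ∀ k < n, ∀ l, l + 1 < n → q k ≠ e l)
    (se : ∀ k < n, ∀ l, l + 1 < n → s k ≠ e l) :
    chiLAT (firecracker n 1) = 2 := by
  have wl : ∀ k : Fin n, totalWeight (firecracker n 1) (combVert p s) (combEdge q e) (Sum.inl k) =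
      if (k : ℕ) % 2 = 0 then B else A := by
    intro k
    rw [totalWeight, weight_inl, ← hpq k k.2]
    rfl
  have wr : ∀ (k : Fin n) (z : Fin 1),
      totalWeight (firecracker n 1) (combVert p s) (combEdge q e) (Sum.inr (k, z)) =
      if (k : ℕ) % 2 = 0 then A else B := by
    intro k z
    rw [totalWeight, weight_inr, ← hsq k k.2]
    rfl
  have hcard : Fintype.card (Fin n ⊕ Fin n × Fin 1) + (firecracker n 1).edgeFinset.card
      = 4 * n - 1 := by
    rw [card_edge_comb]
    simp
    omega
  have hlab : IsLocalAntimagicTotal (firecracker n 1) (combVert p s) (combEdge q e) := by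
    refine ⟨?_, ?_⟩
    · rw [hcard]
      have hD : (Set.range Sum.inl ∪ Sum.inr '' (firecracker n 1).edgeSet :
          Set ((Fin n ⊕ Fin n × Fin 1) ⊕ Sym2 (Fin n ⊕ Fin n × Fin 1))) =
          ((Finset.univ.image Sum.inl ∪ (firecracker n 1).edgeFinset.image Sum.inr :
            Finset ((Fin n ⊕ Fin n × Fin 1) ⊕ Sym2 (Fin n ⊕ Fin n × Fin 1))) :
            Set ((Fin n ⊕ Fin n × Fin 1) ⊕ Sym2 (Fin n ⊕ Fin n × Fin 1))) := by
        ext x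
        simp
      have hmaps : Set.MapsTo (Sum.elim (combVert (n := n) p s) (combEdge q e))
          (Set.range Sum.inl ∪ Sum.inr '' (firecracker n 1).edgeSet) (Set.Icc 1 (4 * n - 1)) := by
        rintro x (⟨(i | ⟨i, z⟩), rfl⟩ | ⟨x, hx, rfl⟩)
        · exact rp i i.2
        · exact rs i i.2
        · rw [mem_edgeSet_comb] at hx
          rcases hx with ⟨i, rfl⟩ | ⟨i, rfl⟩
          · exact rq i i.2
          · simp only [Sum.elim_inr, combEdge_link]
            exact re i (by omega)
      have hinj : Set.InjOn (Sum.elim (combVert (n := n) p s) (combEdge q e))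
          (Set.range Sum.inl ∪ Sum.inr '' (firecracker n 1).edgeSet) := by
        have key : ∀ x ∈ (Set.range Sum.inl ∪ Sum.inr '' (firecracker n 1).edgeSet :
          Set ((Fin n ⊕ Fin n × Fin 1) ⊕ Sym2 (Fin n ⊕ Fin n × Fin 1))),
          (∃ i : Fin n, x = Sum.inl (Sum.inl i)) ∨ (∃ i : Fin n, x = Sum.inl (Sum.inr (i, 0))) ∨
          (∃ i : Fin n, x = Sum.inr (pend i)) ∨ (∃ i : Fin (n - 1), x = Sum.inr (link i)) := by
          rintro x (⟨(i | ⟨i, z⟩), rfl⟩ | ⟨x, hx, rfl⟩)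
          · exact Or.inl ⟨i, rfl⟩
          · obtain rfl := Subsingleton.elim z 0
            exact Or.inr (Or.inl ⟨i, rfl⟩)
          · rw [mem_edgeSet_comb] at hx
            rcases hx with ⟨i, rfl⟩ | ⟨i, rfl⟩
            · exact Or.inr (Or.inr (Or.inl ⟨i, rfl⟩))
            · exact Or.inr (Or.inr (Or.inr ⟨i, rfl⟩))
        intro x hx y hy hxy
        rcases key x hx with ⟨i, rfl⟩ | ⟨i, rfl⟩ | ⟨i, rfl⟩ | ⟨i, rfl⟩ <;>
        rcases key y hy with ⟨j, rfl⟩ | ⟨j, rfl⟩ | ⟨j, rfl⟩ | ⟨j, rfl⟩ <;>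
        simp only [Sum.elim_inl, Sum.elim_inr, combVert, combEdge_pend, combEdge_link] at hxy
        · rw [Fin.ext (pp i i.2 j j.2 hxy)]
        · exact absurd hxy (ps i i.2 j j.2)
        · exact absurd hxy (pq i i.2 j j.2)
        · exact absurd hxy (pe i i.2 j (by omega))
        · exact absurd hxy.symm (ps j j.2 i i.2)
        · rw [Fin.ext (ss i i.2 j j.2 hxy)]
        · exact absurd hxy.symm (qs j j.2 i i.2)
        · exact absurd hxy (se i i.2 j (by omega))
        · exact absurd hxy.symm (pq j j.2 i i.2)
        · exact absurd hxy (qs i i.2 j j.2)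
        · rw [Fin.ext (qq i i.2 j j.2 hxy)]
        · exact absurd hxy (qe i i.2 j (by omega))
        · exact absurd hxy.symm (pe j j.2 i (by omega))
        · exact absurd hxy.symm (se j j.2 i (by omega))
        · exact absurd hxy.symm (qe j j.2 i (by omega))
        · rw [Fin.ext (ee i j (by omega) (by omega) hxy)]
      refine ⟨hmaps, hinj, ?_⟩
      rw [hD] at hmaps hinj ⊢
      rw [← Finset.coe_Icc] at hmaps ⊢
      refine Finset.surjOn_of_injOn_of_card_le _ hmaps hinj ?_
      rw [Finset.card_union_of_disjoint, Finset.card_image_of_injective _ Sum.inl_injective,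
        Finset.card_image_of_injective _ Sum.inr_injective, Finset.card_univ, hcard]
      · simp
      · rw [Finset.disjoint_left]
        intro x hx hy
        simp only [Finset.mem_image] at hx hy
        obtain ⟨a, -, rfl⟩ := hx
        obtain ⟨b, -, h⟩ := hy
        exact absurd h (by simp)
    · have adjw : ∀ x ∈ (firecracker n 1).edgeSet, ∀ u v, x = s(u, v) →
          totalWeight (firecracker n 1) (combVert p s) (combEdge q e) u ≠
          totalWeight (firecracker n 1) (combVert p s) (combEdge q e) v := by
        intro x hx u v huv
        rw [mem_edgeSet_comb] at hx
        rcases hx with ⟨i, rfl⟩ | ⟨i, rfl⟩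
        · rw [pend, Sym2.eq_iff] at huv
          rcases huv with ⟨rfl, rfl⟩ | ⟨rfl, rfl⟩ <;> rw [wl, wr] <;> split_ifs <;> omega
        · rw [link, Sym2.eq_iff] at huv
          rcases huv with ⟨rfl, rfl⟩ | ⟨rfl, rfl⟩ <;> rw [wr, wr] <;> simp only <;>
            split_ifs <;> omega
      intro u v huv
      exact adjw s(u, v) huv u v rfl
  have hcount : totalColorCount (firecracker n 1) (combVert p s) (combEdge q e) = 2 := by
    apply le_antisymm _ (two_le_count hn hlab)
    rw [totalColorCount]
    refine le_trans (Finset.card_le_card (t := {A, B}) ?_) Finset.card_le_two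
    intro c hc
    simp only [Finset.mem_image, Finset.mem_univ, true_and] at hc
    obtain ⟨(k | ⟨k, z⟩), rfl⟩ := hc
    · rw [wl]; split_ifs <;> simp
    · rw [wr]; split_ifs <;> simp
  rw [chiLAT]
  apply le_antisymm
  · exact Nat.sInf_le ⟨_, _, hlab, hcount⟩
  · refine le_csInf ⟨2, _, _, hlab, hcount⟩ ?_
    rintro c ⟨gv, ge, h, rfl⟩
    exact two_le_count hn h

lemma comb_odd {m : ℕ} (hm : 1 ≤ m) : chiLAT (firecracker (2 * m + 1) 1) = 2 := by
  apply chiLAT_of_scheme (by omega)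
    (fun k => if k % 2 = 0 then 7 * m + 3 + k / 2 else 6 * m + 2 + k / 2)
    (fun k => if k % 2 = 0 then 3 * m + 1 - k / 2 else 4 * m + 1 - k / 2)
    (fun k => if k = 2 * m then 7 * m + 2 else
      if k % 2 = 0 then 5 * m + 2 + k / 2 else 4 * m + 2 + k / 2)
    (fun k => if k % 2 = 0 then 2 * m - k / 2 else 1 + k / 2)
    (10 * m + 3) (10 * m + 4)
  all_goals intros; grind

lemma comb_even {m : ℕ} (hm : 2 ≤ m) : chiLAT (firecracker (2 * m) 1) = 2 := by
  apply chiLAT_of_scheme (by omega)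
    (fun k => if k % 2 = 0 then 6 * m - 1 + k / 2 else 7 * m + k / 2)
    (fun k => if k % 2 = 0 then 4 * m - 1 - k / 2 else 3 * m - 1 - k / 2)
    (fun k => if k = 0 then 5 * m else if k = 1 then 4 * m else if k + 1 = 2 * m then 7 * m - 1 else
      if k % 2 = 0 then 4 * m + k / 2 else 5 * m + k / 2)
    (fun k => if k = 0 then m else if k % 2 = 0 then k / 2 else 2 * m - 1 - k / 2)
    (10 * m - 1) (10 * m - 2)
  all_goals intros; grind

/-- For every integer `n ≥ 3`, the local antimagic total chromatic number of
the firecracker graph `F_{n,1}` equals 2. -/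
theorem chiLAT_firecracker_one {n : ℕ} (hn : 3 ≤ n) :
    chiLAT (firecracker n 1) = 2 := by
  rcases Nat.even_or_odd' n with ⟨m, rfl | rfl⟩
  · exact comb_even (by omega)
  · exact comb_odd (by omega)

end LocalAntimagic
end
end

section
/- For all integers n ≥ 3 and k ≥ 2, the local antimagic total chromatic number of the firecracker graph F_{n,k} satisfies 2 ≤ χ_lat(F_{n,k}) ≤ 3. -/
/-!
Local antimagic (total) labelings and chromatic numbers, firecracker graphs,
stars, double stars, joins, and edge-corona products.
-/

open scoped Classical

noncomputable section

namespace LocalAntimagic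

variable {V : Type*} [Fintype V]

/-- A permutation of `[0, 2m)` (with `m = 2w` or `m = 2w + 1`, `c = m - 2w`) whose displacements are exactly
`±1, …, ±m`, made of five order-reversing pieces. -/
def zig (w c i : ℕ) : ℕ :=
  if i < w then 2 * w - 1 + c - i
  else if i < 2 * w - 1 + c then 2 * w - 2 + c - i
  else if i < 3 * w - 1 + 2 * c then 6 * w - 2 + 3 * c - i
  else if i = 3 * w - 1 + 2 * c then w - 1 + c
  else 6 * w - 1 + 3 * c - i

/-- The combinatorial content of the labeling, with the offsets removed. -/
def Core (n k : ℕ) : Prop :=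
  ∃ (S P U : ℕ → ℕ) (τ : ℕ → ℕ → ℕ) (B : ℕ), 2 * n ≤ B ∧
    (∀ i, i < n → S i < 3 * n ∧ P i < 3 * n ∧ U i < 3 * n) ∧
    (∀ i j, i < n → j < n → S i ≠ P j ∧ S i ≠ U j ∧ P i ≠ U j) ∧
    (∀ i j, i < n → j < n → S i = S j → i = j) ∧
    (∀ i j, i < n → j < n → P i = P j → i = j) ∧
    (∀ i j, i < n → j < n → U i = U j → i = j) ∧
    (∀ i, i + 1 < n → P i + S i = 2 * n - 1) ∧
    P (n - 1) + S (n - 1) = 2 * n - 1 + n / 2 ∧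
    (∀ j i, i < n → τ j i < n) ∧
    (∀ j i i', i < n → i' < n → τ j i = τ j i' → i = i') ∧
    ∀ i, i < n → S i + U i + ∑ j ∈ Finset.range (k - 1), τ j i = B

lemma core_step {n k : ℕ} (hk : 2 ≤ k) (h : Core n k) : Core n (k + 2) := by
  obtain ⟨S, P, U, τ, B, h0, h1, h2, h3, h4, h5, h6, h7, h8, h9, h10⟩ := h
  refine ⟨S, P, U, fun j i => if j < k - 1 then τ j i else if j = k - 1 then i else n - 1 - i,
    B + (n - 1), by omega, h1, h2, h3, h4, h5, h6, h7, ?_, ?_, ?_⟩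
  · intro j i hi
    have := h8 j i hi
    dsimp only
    split_ifs <;> omega
  · intro j i i' hi hi'
    have := h9 j i i' hi hi'
    dsimp only
    split_ifs
    · exact this
    · exact id
    · omega
  · intro i hi
    have e : k + 2 - 1 = (k - 1) + 1 + 1 := by omega
    rw [e, Finset.sum_range_succ, Finset.sum_range_succ, ← h10 i hi]
    have : ∑ j ∈ Finset.range (k - 1),
        (if j < k - 1 then τ j i else if j = k - 1 then i else n - 1 - i)
        = ∑ j ∈ Finset.range (k - 1), τ j i := by
      apply Finset.sum_congr rfl
      intro j hj
      rw [if_pos (Finset.mem_range.1 hj)]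
    rw [this]
    simp
    omega

lemma core_three {n : ℕ} (hn : 3 ≤ n) : Core n 3 := by
  obtain ⟨σ, hσ⟩ : ∃ σ : ℕ → ℕ, ∀ i,
      (i + n / 2 < n ∧ σ i = i + n / 2) ∨ (n ≤ i + n / 2 ∧ σ i + n = i + n / 2) := by
    refine ⟨fun i => if i + n / 2 < n then i + n / 2 else i + n / 2 - n, fun i => ?_⟩
    dsimp only
    split_ifs <;> omega
  refine ⟨fun i => if i = n - 1 then 2 * n - 1 + n / 2 else n + i, fun i => n - 1 - i,
    fun i => if i = n - 1 then 2 * n - 1 else 2 * n + σ i,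
    fun j i => if j = 0 then n - 1 - i else n - 1 - σ i, 5 * n - 2,
    by omega, ?_, ?_, ?_, ?_, ?_, ?_, ?_, ?_, ?_, ?_⟩
  · intro i hi
    have := hσ i
    dsimp only
    split_ifs <;> omega
  · intro i j hi hj
    have := hσ i
    have := hσ j
    dsimp only
    split_ifs <;> omega
  · intro i j hi hj
    dsimp only
    split_ifs <;> omega
  · intro i j hi hj
    dsimp only
    omega
  · intro i j hi hj
    have := hσ i
    have := hσ j
    dsimp only
    split_ifs <;> omega
  · intro i hi
    dsimp only
    split_ifs <;> omega
  · simp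
  · intro j i hi
    dsimp only
    split_ifs <;> omega
  · intro j i i' hi hi'
    have := hσ i
    have := hσ i'
    dsimp only
    split_ifs <;> omega
  · intro i hi
    have := hσ i
    simp [Finset.sum_range_succ]
    split_ifs <;> omega

lemma core_two_odd {n : ℕ} (hn : 3 ≤ n) (ho : n % 2 = 1) : Core n 2 := by
  obtain ⟨σ, hσ⟩ : ∃ σ : ℕ → ℕ, ∀ i,
      (i + n / 2 < n ∧ σ i = i + n / 2) ∨ (n ≤ i + n / 2 ∧ σ i + n = i + n / 2) := by
    refine ⟨fun i => if i + n / 2 < n then i + n / 2 else i + n / 2 - n, fun i => ?_⟩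
    dsimp only
    split_ifs <;> omega
  refine ⟨fun i => if i = n - 1 then 2 * n - 1 + n / 2 else n + i, fun i => n - 1 - i,
    fun i => if i = n - 1 then 2 * n - 1 else 2 * n + σ i,
    fun j i => 3 * (n / 2) - (i + σ i), 3 * n + 3 * (n / 2),
    by omega, ?_, ?_, ?_, ?_, ?_, ?_, ?_, ?_, ?_, ?_⟩
  · intro i hi
    have := hσ i
    dsimp only
    split_ifs <;> omega
  · intro i j hi hj
    have := hσ i
    have := hσ j
    dsimp only
    split_ifs <;> omega
  · intro i j hi hj
    dsimp only
    split_ifs <;> omega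
  · intro i j hi hj
    dsimp only
    omega
  · intro i j hi hj
    have := hσ i
    have := hσ j
    dsimp only
    split_ifs <;> omega
  · intro i hi
    dsimp only
    split_ifs <;> omega
  · simp
  · intro j i hi
    have := hσ i
    dsimp only
    omega
  · intro j i i' hi hi'
    have := hσ i
    have := hσ i'
    dsimp only
    omega
  · intro i hi
    have := hσ i
    simp
    split_ifs <;> omega

lemma core_two_even {n : ℕ} (hn : 3 ≤ n) (he : n % 2 = 0) : Core n 2 := by
  obtain ⟨w, c, hw, hc, hnw⟩ : ∃ w c, 1 ≤ w ∧ c ≤ 1 ∧ n = 4 * w + 2 * c :=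
    ⟨n / 4, (n % 4) / 2, by omega, by omega, by omega⟩
  have hlt : ∀ i, i < n → zig w c i < n := by
    intro i hi
    unfold zig
    split_ifs <;> omega
  have hinj : ∀ i j, i < n → j < n → zig w c i = zig w c j → i = j := by
    intro i j hi hj
    unfold zig
    split_ifs <;> omega
  have hd : ∀ i, i < n → zig w c i ≠ i ∧ zig w c i ≤ i + n / 2 ∧ i ≤ zig w c i + n / 2 := by
    intro i hi
    unfold zig
    split_ifs <;> omega
  have hdinj : ∀ i j, i < n → j < n → zig w c i + j = zig w c j + i → i = j := by
    intro i j hi hj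
    unfold zig
    split_ifs <;> omega
  refine ⟨fun i => n - 1 - i, fun i => if i = n - 1 then 2 * n - 1 + n / 2 else n + i,
    fun i => 2 * n - 1 + n / 2 + zig w c (n - 1 - i) - (n - 1 - i),
    fun j i => n - 1 - zig w c (n - 1 - i), 3 * n - 2 + n / 2,
    by omega, ?_, ?_, ?_, ?_, ?_, ?_, ?_, ?_, ?_, ?_⟩
  · intro i hi
    have := hd (n - 1 - i) (by omega)
    dsimp only
    split_ifs <;> omega
  · intro i j hi hj
    have := hd (n - 1 - j) (by omega)
    dsimp only
    split_ifs <;> omega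
  · intro i j hi hj
    dsimp only
    omega
  · intro i j hi hj
    dsimp only
    split_ifs <;> omega
  · intro i j hi hj h
    have := hd (n - 1 - i) (by omega)
    have := hd (n - 1 - j) (by omega)
    have := hdinj (n - 1 - i) (n - 1 - j) (by omega) (by omega)
    dsimp only at h
    omega
  · intro i hi
    dsimp only
    split_ifs <;> omega
  · simp
  · intro j i hi
    dsimp only
    omega
  · intro j i i' hi hi' h
    have := hlt (n - 1 - i) (by omega)
    have := hlt (n - 1 - i') (by omega)
    have := hinj (n - 1 - i) (n - 1 - i') (by omega) (by omega)
    dsimp only at h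
    omega
  · intro i hi
    have := hlt (n - 1 - i) (by omega)
    have := hd (n - 1 - i) (by omega)
    simp
    omega

lemma core_exists {n : ℕ} (hn : 3 ≤ n) : ∀ k, 2 ≤ k → Core n k
  | 0, h => absurd h (by omega)
  | 1, h => absurd h (by omega)
  | 2, _ => by
    rcases Nat.mod_two_eq_zero_or_one n with h | h
    · exact core_two_even hn h
    · exact core_two_odd hn h
  | 3, _ => core_three hn
  | k + 4, _ => core_step (by omega) (core_exists hn (k + 2) (by omega))

/-- Edge labels as a symmetric function of the two endpoints. -/
def pairLab {n k : ℕ} (sp : Fin n → Fin k → ℕ) (E : ℕ → ℕ) :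
    (Fin n ⊕ Fin n × Fin k) → (Fin n ⊕ Fin n × Fin k) → ℕ
  | Sum.inl _, Sum.inr (i, j) => sp i j
  | Sum.inr (i, j), Sum.inl _ => sp i j
  | Sum.inr (i, _), Sum.inr (i', _) => E (min i i')
  | Sum.inl _, Sum.inl _ => 0

lemma pairLab_symm {n k : ℕ} (sp : Fin n → Fin k → ℕ) (E : ℕ → ℕ) (a b) :
    pairLab sp E a b = pairLab sp E b a := by
  rcases a with a | ⟨a, a'⟩ <;> rcases b with b | ⟨b, b'⟩ <;> simp [pairLab, min_comm]

/-- The edge labeling on `Sym2`. -/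
def edgeLab {n k : ℕ} (sp : Fin n → Fin k → ℕ) (E : ℕ → ℕ) :
    Sym2 (Fin n ⊕ Fin n × Fin k) → ℕ :=
  Sym2.lift ⟨pairLab sp E, pairLab_symm sp E⟩

/-- Enumeration of the edges of the firecracker. -/
def edgeEnum (n k : ℕ) (hk : 0 < k) :
    (Fin n × Fin k) ⊕ Fin (n - 1) → Sym2 (Fin n ⊕ Fin n × Fin k)
  | Sum.inl (i, j) => s(Sum.inl i, Sum.inr (i, j))
  | Sum.inr i => s(Sum.inr (⟨i, by omega⟩, ⟨0, hk⟩), Sum.inr (⟨i + 1, by omega⟩, ⟨0, hk⟩))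

lemma adj_ll {n k : ℕ} (i i' : Fin n) :
    ¬ (firecracker n k).Adj (Sum.inl i) (Sum.inl i') := by
  simp [firecracker]

lemma adj_lr {n k : ℕ} (i i' : Fin n) (j : Fin k) :
    (firecracker n k).Adj (Sum.inl i) (Sum.inr (i', j)) ↔ i = i' := by
  simp [firecracker]

lemma adj_rl {n k : ℕ} (i i' : Fin n) (j : Fin k) :
    (firecracker n k).Adj (Sum.inr (i', j)) (Sum.inl i) ↔ i = i' := by
  rw [SimpleGraph.adj_comm, adj_lr]

lemma adj_rr {n k : ℕ} (i i' : Fin n) (j j' : Fin k) :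
    (firecracker n k).Adj (Sum.inr (i, j)) (Sum.inr (i', j')) ↔
      (j : ℕ) = 0 ∧ (j' : ℕ) = 0 ∧ ((i' : ℕ) = i + 1 ∨ (i : ℕ) = i' + 1) := by
  simp only [firecracker, SimpleGraph.fromRel_adj, ne_eq, Sum.inr.injEq, Prod.mk.injEq, Fin.ext_iff]
  omega

lemma edgeEnum_injective (n k : ℕ) (hk : 0 < k) : Function.Injective (edgeEnum n k hk) := by
  rintro (⟨i, j⟩ | i) (⟨i', j'⟩ | i') h
  · simp [edgeEnum] at h
    simp [h]
  · simp [edgeEnum] at h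
  · simp [edgeEnum] at h
  · simp [edgeEnum] at h
    simp only [Sum.inr.injEq, Fin.ext_iff]
    omega

lemma range_edgeEnum (n k : ℕ) (hk : 0 < k) :
    Set.range (edgeEnum n k hk) = (firecracker n k).edgeSet := by
  ext e
  constructor
  · rintro ⟨⟨i, j⟩ | i, rfl⟩
    · simp [edgeEnum, adj_lr]
    · simp [edgeEnum, adj_rr]
  · induction e using Sym2.ind with
    | _ a b =>
      intro h
      rw [SimpleGraph.mem_edgeSet] at h
      rcases a with a | ⟨a, a'⟩ <;> rcases b with b | ⟨b, b'⟩
      · exact absurd h (adj_ll _ _)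
      · rw [adj_lr] at h
        subst h
        exact ⟨Sum.inl (a, b'), rfl⟩
      · rw [adj_rl] at h
        subst h
        exact ⟨Sum.inl (b, a'), Sym2.eq_swap⟩
      · rw [adj_rr] at h
        obtain ⟨h1, h2, h3⟩ := h
        obtain rfl : a' = ⟨0, hk⟩ := Fin.ext h1
        obtain rfl : b' = ⟨0, hk⟩ := Fin.ext h2
        rcases h3 with h3 | h3
        · refine ⟨Sum.inr ⟨a, by omega⟩, ?_⟩
          obtain ⟨b, hb⟩ := b
          dsimp only at h3
          subst h3
          rfl
        · refine ⟨Sum.inr ⟨b, by omega⟩, ?_⟩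
          obtain ⟨a, ha⟩ := a
          dsimp only at h3
          subst h3
          exact Sym2.eq_swap

lemma card_edge (n k : ℕ) (hk : 0 < k) :
    (firecracker n k).edgeFinset.card = n * k + (n - 1) := by
  have : (firecracker n k).edgeFinset = Finset.univ.image (edgeEnum n k hk) := by
    ext e
    rw [SimpleGraph.mem_edgeFinset, ← range_edgeEnum n k hk]
    simp
  rw [this, Finset.card_image_of_injective _ (edgeEnum_injective n k hk)]
  simp

lemma weight_eq_s7 {V : Type*} [Fintype V] (G : SimpleGraph V) (f : Sym2 V → ℕ) (u : V) :
    weight G f u = ∑ v, if G.Adj u v then f s(u, v) else 0 := by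
  unfold weight
  rw [← Finset.sum_filter, ← Finset.sum_filter]
  symm
  apply Finset.sum_bij (fun v _ => s(u, v))
  · intro v hv
    simpa using hv
  · intro a _ b _ h
    exact Sym2.congr_right.1 h
  · intro e he
    simp only [Finset.mem_filter, SimpleGraph.mem_edgeFinset] at he
    obtain ⟨h1, v, rfl⟩ := he
    exact ⟨v, by simpa using h1, rfl⟩
  · intro _ _
    rfl

lemma weight_center_s7 {n k : ℕ} (sp : Fin n → Fin k → ℕ) (E : ℕ → ℕ) (i : Fin n) :
    weight (firecracker n k) (edgeLab sp E) (Sum.inl i) = ∑ j, sp i j := by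
  rw [weight_eq_s7, Fintype.sum_sum_type, Fintype.sum_prod_type]
  simp only [adj_ll, adj_lr, if_false, Finset.sum_const_zero, zero_add]
  rw [Finset.sum_eq_single i]
  · simp [edgeLab, pairLab]
  · intro b _ hb
    simp [hb.symm]
  · simp

lemma weight_leaf_s7 {n k : ℕ} (sp : Fin n → Fin k → ℕ) (E : ℕ → ℕ) (i : Fin n) (j : Fin k)
    (hj : (j : ℕ) ≠ 0) :
    weight (firecracker n k) (edgeLab sp E) (Sum.inr (i, j)) = sp i j := by
  rw [weight_eq_s7, Fintype.sum_sum_type, Fintype.sum_prod_type]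
  simp only [adj_rl, adj_rr, hj, false_and, if_false, Finset.sum_const_zero, add_zero]
  simp [edgeLab, pairLab]

lemma weight_path {n k : ℕ} (sp : Fin n → Fin k → ℕ) (E : ℕ → ℕ) (i : Fin n) (j : Fin k)
    (hj : (j : ℕ) = 0) :
    weight (firecracker n k) (edgeLab sp E) (Sum.inr (i, j)) =
      sp i j + ((if 0 < (i : ℕ) then E (i - 1) else 0) + if (i : ℕ) + 1 < n then E i else 0) := by
  have hk : 0 < k := lt_of_le_of_lt (Nat.zero_le _) j.2
  rw [weight_eq_s7, Fintype.sum_sum_type, Fintype.sum_prod_type]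
  congr 1
  · simp [adj_rl, edgeLab, pairLab]
  · have h1 : ∀ i' : Fin n, (∑ j' : Fin k,
        if (firecracker n k).Adj (Sum.inr (i, j)) (Sum.inr (i', j')) then
          edgeLab sp E s(Sum.inr (i, j), Sum.inr (i', j')) else 0) =
        (if (i : ℕ) = i' + 1 then E (i - 1) else 0) + if (i' : ℕ) = i + 1 then E i else 0 := by
      intro i'
      rw [Finset.sum_eq_single ⟨0, hk⟩]
      · simp only [adj_rr, hj, true_and, edgeLab, Sym2.lift_mk, pairLab]
        by_cases a : (i : ℕ) = i' + 1
        · have : ¬ (i' : ℕ) = i + 1 := by omega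
          have e : min (i : ℕ) i' = i - 1 := by omega
          simp [a]
          omega
        · by_cases b : (i' : ℕ) = i + 1
          · simp [b]
            omega
          · simp [a, b]
      · intro b _ hb
        have : ¬ (b : ℕ) = 0 := fun h => hb (Fin.ext h)
        simp [adj_rr, this]
      · simp
    rw [Finset.sum_congr rfl (fun i' _ => h1 i'), Finset.sum_add_distrib]
    congr 1
    · split_ifs with h
      · rw [Finset.sum_eq_single ⟨i - 1, by omega⟩]
        · rw [if_pos]
          simp only
          omega
        · intro b _ hb
          rw [if_neg]
          intro h'
          exact hb (Fin.ext (by simp only; omega))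
        · simp
      · apply Finset.sum_eq_zero
        intro b _
        rw [if_neg (by omega)]
    · split_ifs with h
      · rw [Finset.sum_eq_single ⟨i + 1, h⟩]
        · simp
        · intro b _ hb
          rw [if_neg]
          intro h'
          exact hb (Fin.ext h')
        · simp
      · apply Finset.sum_eq_zero
        intro b _
        rw [if_neg (by omega)]

/-- The path-edge labels `n-1, 1, n-2, 2, …`. -/
def pathLab (n i : ℕ) : ℕ := if i % 2 = 0 then n - 1 - i / 2 else (i + 1) / 2

lemma exists_labeling_s7 {n k : ℕ} (hn : 3 ≤ n) (hk : 2 ≤ k) :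
    ∃ gv ge, IsLocalAntimagicTotal (firecracker n k) gv ge ∧
      totalColorCount (firecracker n k) gv ge ≤ 3 := by
  obtain ⟨S, P, U, τ, B, h0, h1, h2, h3, h4, h5, h6, h7, h8, h9, h10⟩ := core_exists hn k hk
  have hk0 : 0 < k := by omega
  obtain ⟨W, hW⟩ : ∃ W, W = n * k := ⟨_, rfl⟩
  -- indices of the leaf pairs
  obtain ⟨T, hT⟩ : ∃ T : ℕ → ℕ → ℕ, ∀ i j, T i j = (j - 1) * n + τ (j - 1) i :=
    ⟨_, fun _ _ => rfl⟩
  have hTlt : ∀ i j, i < n → j ≠ 0 → j < k → T i j + n < W := by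
    intro i j hi hj hjk
    have := h8 (j - 1) i hi
    obtain ⟨q, rfl⟩ : ∃ q, j = q + 1 := ⟨j - 1, by omega⟩
    obtain ⟨r, rfl⟩ : ∃ r, k = q + 2 + r := ⟨k - (q + 2), by omega⟩
    rw [hT, hW]
    simp only [Nat.add_sub_cancel] at *
    nlinarith [Nat.zero_le (n * r)]
  have hTinj : ∀ i j i' j', i < n → i' < n → j ≠ 0 → j' ≠ 0 → T i j = T i' j' →
      i = i' ∧ j = j' := by
    intro i j i' j' hi hi' hj hj' h
    have a := h8 (j - 1) i hi
    have b := h8 (j' - 1) i' hi'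
    rw [hT, hT] at h
    have e1 : ((j - 1) * n + τ (j - 1) i) / n = j - 1 := by
      rw [mul_comm, Nat.mul_add_div (by omega), Nat.div_eq_of_lt a, add_zero]
    have e2 : ((j' - 1) * n + τ (j' - 1) i') / n = j' - 1 := by
      rw [mul_comm, Nat.mul_add_div (by omega), Nat.div_eq_of_lt b, add_zero]
    have e3 : j - 1 = j' - 1 := by rw [← e1, h, e2]
    rw [e3] at h
    exact ⟨h9 (j' - 1) i i' hi hi' (Nat.add_left_cancel h), by omega⟩
  have hWn : 2 * n ≤ W := by rw [hW]; nlinarith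
  obtain ⟨sp, hsp⟩ : ∃ sp : Fin n → Fin k → ℕ, ∀ i j,
      sp i j = if (j : ℕ) = 0 then W + S i else n + T i j := ⟨_, fun _ _ => rfl⟩
  obtain ⟨gv, hgl, hgr⟩ : ∃ gv : Fin n ⊕ Fin n × Fin k → ℕ, (∀ i, gv (Sum.inl i) = W + U i) ∧
      ∀ i j, gv (Sum.inr (i, j)) =
        if (j : ℕ) = 0 then W + P i else 2 * W + 2 * n - 1 - T i j :=
    ⟨Sum.elim (fun i => W + U i)
      (fun p => if (p.2 : ℕ) = 0 then W + P p.1 else 2 * W + 2 * n - 1 - T p.1 p.2),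
      fun _ => rfl, fun _ _ => rfl⟩
  -- total weights
  have wl : ∀ i : Fin n, totalWeight (firecracker n k) gv (edgeLab sp (pathLab n)) (Sum.inl i) =
      2 * W + B + ∑ j ∈ Finset.range (k - 1), (n + j * n) := by
    intro i
    rw [totalWeight, weight_center_s7, hgl, ← h10 i i.2]
    obtain ⟨r, rfl⟩ : ∃ r, k = r + 1 := ⟨k - 1, by omega⟩
    rw [Fin.sum_univ_succ]
    simp only [hsp, hT]
    simp only [Fin.val_zero, if_true, Fin.val_succ, Nat.add_sub_cancel, Nat.succ_ne_zero, if_false]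
    rw [Fin.sum_univ_eq_sum_range (fun j => n + (j * n + τ j i)) r]
    simp only [← add_assoc]
    rw [Finset.sum_add_distrib]
    ring
  have wleaf : ∀ (i : Fin n) (j : Fin k), (j : ℕ) ≠ 0 →
      totalWeight (firecracker n k) gv (edgeLab sp (pathLab n)) (Sum.inr (i, j)) =
      2 * W + 3 * n - 1 := by
    intro i j hj
    rw [totalWeight, weight_leaf_s7 _ _ _ _ hj, hgr, hsp, if_neg hj, if_neg hj]
    have := hTlt i j i.2 hj j.2
    omega
  have wpath : ∀ (i : Fin n) (j : Fin k), (j : ℕ) = 0 →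
      totalWeight (firecracker n k) gv (edgeLab sp (pathLab n)) (Sum.inr (i, j)) =
      2 * W + 3 * n - 2 + (i : ℕ) % 2 := by
    intro i j hj
    rw [totalWeight, weight_path _ _ _ _ hj, hgr, hsp, if_pos hj, if_pos hj]
    have hi := i.2
    unfold pathLab
    by_cases hl : (i : ℕ) + 1 < n
    · have := h6 i hl
      rw [if_pos hl]
      split_ifs <;> omega
    · have e : (i : ℕ) = n - 1 := by omega
      rw [if_neg hl, if_pos (by omega), e]
      split_ifs <;> omega
  have hB : 2 * W + 3 * n ≤ 2 * W + B + ∑ j ∈ Finset.range (k - 1), (n + j * n) := by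
    have : n + 0 * n ≤ ∑ j ∈ Finset.range (k - 1), (n + j * n) :=
      Finset.single_le_sum (f := fun j => n + j * n) (fun _ _ => Nat.zero_le _)
        (Finset.mem_range.2 (by omega))
    omega
  generalize 2 * W + B + ∑ j ∈ Finset.range (k - 1), (n + j * n) = C at wl hB
  refine ⟨gv, edgeLab sp (pathLab n), ⟨?_, ?_⟩, ?_⟩
  · have hset : Set.range Sum.inl ∪ Sum.inr '' (firecracker n k).edgeSet =
        Set.range (Sum.map id (edgeEnum n k hk0) :
          (Fin n ⊕ Fin n × Fin k) ⊕ ((Fin n × Fin k) ⊕ Fin (n - 1)) → _) := by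
      rw [← range_edgeEnum n k hk0]
      ext x
      constructor
      · rintro (⟨v, rfl⟩ | ⟨_, ⟨e, rfl⟩, rfl⟩)
        · exact ⟨Sum.inl v, rfl⟩
        · exact ⟨Sum.inr e, rfl⟩
      · rintro ⟨v | e, rfl⟩
        · exact Or.inl ⟨v, rfl⟩
        · exact Or.inr ⟨_, ⟨e, rfl⟩, rfl⟩
    have hcard : Fintype.card (Fin n ⊕ Fin n × Fin k) + (firecracker n k).edgeFinset.card =
        2 * W + 2 * n - 1 := by
      rw [card_edge n k hk0]
      simp only [Fintype.card_sum, Fintype.card_prod, Fintype.card_fin]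
      omega
    rw [hset, hcard]
    obtain ⟨F, hF⟩ : ∃ F : (Fin n ⊕ Fin n × Fin k) ⊕ ((Fin n × Fin k) ⊕ Fin (n - 1)) → ℕ,
        F = Sum.elim gv (edgeLab sp (pathLab n)) ∘ Sum.map id (edgeEnum n k hk0) := ⟨_, rfl⟩
    have f1 : ∀ i, F (Sum.inl (Sum.inl i)) = W + U i := by
      intro i
      rw [hF, ← hgl]
      rfl
    have f2 : ∀ i j, F (Sum.inl (Sum.inr (i, j))) =
        if (j : ℕ) = 0 then W + P i else 2 * W + 2 * n - 1 - T i j := by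
      intro i j
      rw [hF, ← hgr]
      rfl
    have f3 : ∀ i j, F (Sum.inr (Sum.inl (i, j))) =
        if (j : ℕ) = 0 then W + S i else n + T i j := by
      intro i j
      rw [hF, ← hsp]
      rfl
    have f4 : ∀ i, F (Sum.inr (Sum.inr i)) = pathLab n i := by
      intro i
      rw [hF]
      simp [edgeEnum, edgeLab, pairLab]
    have pl : ∀ i, i < n - 1 → 1 ≤ pathLab n i ∧ pathLab n i < n := by
      intro i hi
      unfold pathLab
      split_ifs <;> omega
    have plinj : ∀ i j, i < n - 1 → j < n - 1 → pathLab n i = pathLab n j → i = j := by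
      intro i j hi hj
      unfold pathLab
      split_ifs <;> omega
    -- a classification of the labels by range
    have r1 : ∀ i : Fin n, S i < 3 * n ∧ P i < 3 * n ∧ U i < 3 * n := fun i => h1 i i.2
    have r2 : ∀ (i : Fin n) (j : Fin k), (j : ℕ) ≠ 0 → T i j + n < W :=
      fun i j hj => hTlt i j i.2 hj j.2
    have r3 : ∀ i : Fin (n - 1), 1 ≤ pathLab n i ∧ pathLab n i < n := fun i => pl i i.2
    have r4 : ∀ i j : Fin n, S i ≠ P j ∧ S i ≠ U j ∧ P i ≠ U j := fun i j => h2 i j i.2 j.2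
    have z : ∀ j j' : Fin k, (j : ℕ) = 0 → (j' : ℕ) = 0 → j = j' :=
      fun j j' a b => Fin.ext (a.trans b.symm)
    have tinj : ∀ (i i' : Fin n) (j j' : Fin k), (j : ℕ) ≠ 0 → (j' : ℕ) ≠ 0 →
        T i j = T i' j' → i = i' ∧ j = j' := by
      intro i i' j j' hj hj' h
      obtain ⟨a, b⟩ := hTinj _ _ _ _ i.2 i'.2 hj hj' h
      exact ⟨Fin.ext a, Fin.ext b⟩
    have hinj : Function.Injective F := by
      rintro ((i | ⟨i, j⟩) | (⟨i, j⟩ | i)) ((i' | ⟨i', j'⟩) | (⟨i', j'⟩ | i')) h <;>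
        simp only [f1, f2, f3, f4] at h
      · rw [Fin.ext (h5 i i' i.2 i'.2 (by omega))]
      · exfalso
        have := r1 i; have := r4 i' i; have := r2 i' j'
        split_ifs at h <;> omega
      · exfalso
        have := r1 i; have := r4 i' i; have := r2 i' j'
        split_ifs at h <;> omega
      · exfalso
        have := r3 i'; omega
      · exfalso
        have := r1 i'; have := r4 i i'; have := r2 i j
        split_ifs at h <;> omega
      · have := r1 i; have := r1 i'; have := r2 i j; have := r2 i' j'
        split_ifs at h with a b b
        · rw [Fin.ext (h4 i i' i.2 i'.2 (by omega)), z j j' a b]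
        · omega
        · omega
        · obtain ⟨rfl, rfl⟩ := tinj i i' j j' a b (by omega)
          rfl
      · exfalso
        have := r1 i; have := r1 i'; have := r2 i j; have := r2 i' j'; have := r4 i' i
        split_ifs at h <;> omega
      · exfalso
        have := r3 i'; have := r2 i j
        split_ifs at h <;> omega
      · exfalso
        have := r1 i'; have := r4 i i'; have := r2 i j
        split_ifs at h <;> omega
      · exfalso
        have := r1 i; have := r1 i'; have := r2 i j; have := r2 i' j'; have := r4 i i'
        split_ifs at h <;> omega
      · have := r1 i; have := r1 i'; have := r2 i j; have := r2 i' j'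
        split_ifs at h with a b b
        · rw [Fin.ext (h3 i i' i.2 i'.2 (by omega)), z j j' a b]
        · omega
        · omega
        · obtain ⟨rfl, rfl⟩ := tinj i i' j j' a b (by omega)
          rfl
      · exfalso
        have := r3 i'; have := r2 i j
        split_ifs at h <;> omega
      · exfalso
        have := r3 i; omega
      · exfalso
        have := r3 i; have := r2 i' j'
        split_ifs at h <;> omega
      · exfalso
        have := r3 i; have := r2 i' j'
        split_ifs at h <;> omega
      · rw [Fin.ext (plinj i i' i.2 i'.2 h)]
    have hmem : ∀ x, F x ∈ Finset.Icc 1 (2 * W + 2 * n - 1) := by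
      rintro ((i | ⟨i, j⟩) | (⟨i, j⟩ | i)) <;> simp only [f1, f2, f3, f4, Finset.mem_Icc]
      · have := r1 i; omega
      · have := r1 i; have := r2 i j
        split_ifs <;> omega
      · have := r1 i; have := r2 i j
        split_ifs <;> omega
      · have := r3 i; omega
    have himg : Finset.univ.image F = Finset.Icc 1 (2 * W + 2 * n - 1) := by
      apply Finset.eq_of_subset_of_card_le
      · intro y hy
        obtain ⟨x, _, rfl⟩ := Finset.mem_image.1 hy
        exact hmem x
      · rw [Finset.card_image_of_injective _ hinj]
        simp only [Finset.card_univ, Fintype.card_sum, Fintype.card_prod, Fintype.card_fin,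
          Nat.card_Icc]
        omega
    refine ⟨?_, ?_, ?_⟩
    · rintro _ ⟨x, rfl⟩
      have := hmem x
      rw [hF, Finset.mem_Icc] at this
      exact this
    · rintro _ ⟨x, rfl⟩ _ ⟨y, rfl⟩ h
      have : F x = F y := by rw [hF]; exact h
      rw [hinj this]
    · intro y hy
      have : y ∈ Finset.univ.image F := by
        rw [himg, Finset.mem_Icc]
        exact hy
      obtain ⟨x, _, rfl⟩ := Finset.mem_image.1 this
      exact ⟨_, ⟨x, rfl⟩, by rw [hF]; rfl⟩
  · have key : ∀ (i i' : Fin n) (j : Fin k),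
        totalWeight (firecracker n k) gv (edgeLab sp (pathLab n)) (Sum.inl i) ≠
        totalWeight (firecracker n k) gv (edgeLab sp (pathLab n)) (Sum.inr (i', j)) := by
      intro i i' j
      rw [wl]
      by_cases hj : (j : ℕ) = 0
      · rw [wpath _ _ hj]; omega
      · rw [wleaf _ _ hj]; omega
    rintro (i | ⟨i, j⟩) (i' | ⟨i', j'⟩) h
    · exact absurd h (adj_ll _ _)
    · exact key _ _ _
    · exact (key _ _ _).symm
    · obtain ⟨a, b, c⟩ := (adj_rr _ _ _ _).1 h
      rw [wpath _ _ a, wpath _ _ b]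
      omega
  · have hsub : Finset.univ.image
        (totalWeight (firecracker n k) gv (edgeLab sp (pathLab n))) ⊆
        {C, 2 * W + 3 * n - 1, 2 * W + 3 * n - 2} := by
      intro y hy
      obtain ⟨x, _, rfl⟩ := Finset.mem_image.1 hy
      rcases x with i | ⟨i, j⟩
      · simp [wl]
      · by_cases hj : (j : ℕ) = 0
        · rw [wpath _ _ hj]
          simp only [Finset.mem_insert, Finset.mem_singleton]
          omega
        · simp [wleaf _ _ hj]
    exact (Finset.card_le_card hsub).trans Finset.card_le_three

/-- For all integers `n ≥ 3` and `k ≥ 2`, the local antimagic total chromatic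
number of the firecracker graph `F_{n,k}` satisfies `2 ≤ χ_lat(F_{n,k}) ≤ 3`. -/
theorem chiLAT_firecracker_bounds {n k : ℕ} (hn : 3 ≤ n) (hk : 2 ≤ k) :
    2 ≤ chiLAT (firecracker n k) ∧ chiLAT (firecracker n k) ≤ 3 := by
  obtain ⟨gv, ge, h, hc⟩ := exists_labeling_s7 hn hk
  constructor
  · have hne : {c | ∃ gv ge, IsLocalAntimagicTotal (firecracker n k) gv ge ∧
        totalColorCount (firecracker n k) gv ge = c}.Nonempty := ⟨_, gv, ge, h, rfl⟩
    obtain ⟨gv', ge', h', hc'⟩ := Nat.sInf_mem hne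
    have hadj : (firecracker n k).Adj (Sum.inl ⟨0, by omega⟩)
        (Sum.inr (⟨0, by omega⟩, ⟨0, by omega⟩)) := (adj_lr _ _ _).2 rfl
    have hne' := h'.2 _ _ hadj
    rw [chiLAT, ← hc', totalColorCount]
    exact Finset.one_lt_card.2 ⟨_, Finset.mem_image_of_mem _ (Finset.mem_univ _), _,
      Finset.mem_image_of_mem _ (Finset.mem_univ _), hne'⟩
  · have hle : chiLAT (firecracker n k) ≤ totalColorCount (firecracker n k) gv ge :=
      Nat.sInf_le ⟨gv, ge, h, rfl⟩
    exact hle.trans hc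

end LocalAntimagic
end
end
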